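/- arXiv:2511.12741 — 2 statements merged into one kernel-verified Lean document; each statement's English description precedes it below -/
import Mathlib

section
/- Let Ω = B(0,1) ⊂ ℝⁿ, n ≥ 3, let B be an admissible drift, and let g be a Green's function of L = −Δ + B·∇ on Ω with pole at 0. Then there exists a constant K' > 0, depending only on n, M, β, such that g(x) ≤ K' · |x|^{2−n} for every x ∈ Ω with 0 < |x| ≤ 1/2. -/
open Set Metric MeasureTheory Filter
open scoped RealInnerProductSpace Topology

noncomputable section

/-- Euclidean space `ℝⁿ`. -/
abbrev Euc (n : ℕ) := EuclideanSpace ℝ (Fin n)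

/-- The divergence `div B x = ∑ i ∂ᵢ Bᵢ (x)` of a vector field. -/
def divg {n : ℕ} (B : Euc n → Euc n) (x : Euc n) : ℝ :=
  ∑ i : Fin n, ⟪fderiv ℝ B x (EuclideanSpace.single i 1), EuclideanSpace.single i (1 : ℝ)⟫

/-- An admissible drift on the unit ball `Ω = B(0,1)`: `B` is continuously differentiable on
`Ω`, `δ(x)^(1-β) |B(x)| ≤ M` on `Ω` (where `δ(x) = 1 - |x|`), and
`-M δ(x)^(β-2) ≤ div B(x) ≤ 0` on `Ω`. -/
def AdmissibleDrift {n : ℕ} (β M : ℝ) (B : Euc n → Euc n) : Prop :=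
  ContDiffOn ℝ 1 B (ball 0 1) ∧
  (∀ x ∈ ball (0 : Euc n) 1, (1 - ‖x‖) ^ (1 - β) * ‖B x‖ ≤ M) ∧
  (∀ x ∈ ball (0 : Euc n) 1, -(M * (1 - ‖x‖) ^ (β - 2)) ≤ divg B x ∧ divg B x ≤ 0)

/-- A Green's function of `L = -Δ + B·∇` on the unit ball `Ω = B(0,1)` with pole at `y`:
positive on `Ω \ {y}`, three times continuously differentiable there, `g` and `|∇g|`
integrable on `Ω`, `g(x) → 0` as `|x| → 1`, and the weak formulation
`∫_Ω (⟨∇g, ∇φ⟩ + ⟨B, ∇g⟩ φ) = φ(y)` for every test function `φ ∈ C_c^∞(Ω)`. -/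
def IsGreenPole {n : ℕ} (B : Euc n → Euc n) (y : Euc n) (g : Euc n → ℝ) : Prop :=
  (∀ x ∈ ball (0 : Euc n) 1, x ≠ y → 0 < g x) ∧
  ContDiffOn ℝ 3 g (ball 0 1 \ {y}) ∧
  IntegrableOn g (ball 0 1) ∧
  IntegrableOn (fun x => ‖gradient g x‖) (ball 0 1) ∧
  (∀ ε > 0, ∃ t < (1 : ℝ), ∀ x ∈ ball (0 : Euc n) 1, t < ‖x‖ → |g x| < ε) ∧
  (∀ φ : Euc n → ℝ, ContDiff ℝ (⊤ : ℕ∞) φ → HasCompactSupport φ → tsupport φ ⊆ ball 0 1 →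
    (∫ x in ball (0 : Euc n) 1,
      (⟪gradient g x, gradient φ x⟫ + ⟪B x, gradient g x⟫ * φ x)) = φ y)


theorem inner_gradient_eq_fderiv {n : ℕ} (f : Euc n → ℝ) (x v : Euc n) :
    ⟪gradient f x, v⟫ = fderiv ℝ f x v := by
  simp [gradient]

theorem divg_eq_sum_fderiv_apply {n : ℕ} (F : Euc n → Euc n) (x : Euc n) :
    divg F x = ∑ i : Fin n, (fderiv ℝ F x (EuclideanSpace.single i 1)) i := by
  simp [divg, EuclideanSpace.inner_single_right]

theorem map_eq_sum_coord_mul {n : ℕ} (L : Euc n →L[ℝ] ℝ) (v : Euc n) :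
    L v = ∑ i : Fin n, v i * L (EuclideanSpace.single i 1) := by
  conv_lhs => rw [← (EuclideanSpace.basisFun (Fin n) ℝ).sum_repr v]
  simp [map_sum]

theorem divg_add {n : ℕ} {F G : Euc n → Euc n} {x : Euc n}
    (hF : DifferentiableAt ℝ F x) (hG : DifferentiableAt ℝ G x) :
    divg (fun y => F y + G y) x = divg F x + divg G x := by
  simp only [divg_eq_sum_fderiv_apply, ← Finset.sum_add_distrib]
  rw [fderiv_fun_add hF hG]
  simp

theorem divg_smul {n : ℕ} {h : Euc n → ℝ} {F : Euc n → Euc n} {x : Euc n}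
    (hh : DifferentiableAt ℝ h x) (hF : DifferentiableAt ℝ F x) :
    divg (fun y => h y • F y) x = h x * divg F x + fderiv ℝ h x (F x) := by
  simp only [divg_eq_sum_fderiv_apply]
  rw [fderiv_fun_smul hh hF, map_eq_sum_coord_mul (fderiv ℝ h x) (F x), Finset.mul_sum,
    ← Finset.sum_add_distrib]
  refine Finset.sum_congr rfl fun i _ => ?_
  simp [mul_comm]

theorem divg_sub_const {n : ℕ} (x₀ x : Euc n) : divg (fun y => y - x₀) x = n := by
  simp [divg_eq_sum_fderiv_apply, fderiv_sub_const]

theorem continuousOn_divg {n : ℕ} {F : Euc n → Euc n} {s : Set (Euc n)} (hs : IsOpen s)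
    (hF : ContDiffOn ℝ 1 F s) : ContinuousOn (divg F) s := by
  have h := hF.continuousOn_fderiv_of_isOpen hs le_rfl
  unfold divg
  fun_prop

theorem continuous_divg {n : ℕ} {F : Euc n → Euc n} (hF : ContDiff ℝ 1 F) :
    Continuous (divg F) := by
  rw [← continuousOn_univ]
  exact continuousOn_divg isOpen_univ hF.contDiffOn

theorem divg_eq_zero_of_notMem_tsupport {n : ℕ} {F : Euc n → Euc n} {x : Euc n}
    (hx : x ∉ tsupport F) : divg F x = 0 := by
  have h : fderiv ℝ F x = 0 := by
    by_contra h
    exact hx (support_fderiv_subset ℝ h)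
  simp [divg, h]

theorem hasCompactSupport_divg {n : ℕ} {F : Euc n → Euc n} (hF : HasCompactSupport F) :
    HasCompactSupport (divg F) :=
  HasCompactSupport.intro hF fun _ hx => divg_eq_zero_of_notMem_tsupport hx

/-- The divergence of a compactly supported `C¹` vector field integrates to zero. -/
theorem integral_divg_eq_zero {n : ℕ} {F : Euc n → Euc n} (hF : ContDiff ℝ 1 F)
    (hc : HasCompactSupport F) : ∫ x, divg F x = 0 := by
  have hd : Differentiable ℝ F := hF.differentiable one_ne_zero
  have hcont : ∀ i : Fin n, Continuous fun x =>
      (fderiv ℝ F x (EuclideanSpace.single i 1)) i := by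
    have := hF.continuous_fderiv one_ne_zero
    fun_prop
  have hint : ∀ i : Fin n, Integrable fun x =>
      (fderiv ℝ F x (EuclideanSpace.single i 1)) i := fun i =>
    (hcont i).integrable_of_hasCompactSupport <| HasCompactSupport.intro hc fun x hx => by
      have h : fderiv ℝ F x = 0 := by
        by_contra h
        exact hx (support_fderiv_subset ℝ h)
      simp [h]
  simp only [divg_eq_sum_fderiv_apply]
  rw [integral_finsetSum _ fun i _ => hint i]
  refine Finset.sum_eq_zero fun i _ => ?_
  have hi : ∀ x, fderiv ℝ (fun y => F y i) x (EuclideanSpace.single i 1) =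
      (fderiv ℝ F x (EuclideanSpace.single i 1)) i := fun x => by
    have := ((EuclideanSpace.proj i : Euc n →L[ℝ] ℝ).hasFDerivAt.comp x (hd x).hasFDerivAt).fderiv
    have h2 : (⇑(EuclideanSpace.proj i : Euc n →L[ℝ] ℝ) ∘ F) = fun y => F y i := rfl
    rw [h2] at this
    rw [this]; rfl
  have key := integral_mul_fderiv_eq_neg_fderiv_mul_of_integrable (μ := (volume : Measure (Euc n)))
    (f := fun _ : Euc n => (1 : ℝ)) (g := fun y => F y i) (v := EuclideanSpace.single i 1)
    (by simp) (by simpa [hi] using hint i)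
    (by
      simp only [one_mul]
      refine Continuous.integrable_of_hasCompactSupport ?_ ?_
      · have := hF.continuous
        fun_prop
      · exact HasCompactSupport.intro hc fun x hx => by simp [image_eq_zero_of_notMem_tsupport hx])
    (fun _ _ => by fun_prop)
    (fun x _ => by
      have := hd x
      fun_prop)
  simpa [hi] using key

theorem deriv_smoothTransition_eq_zero_of_neg {x : ℝ} (hx : x < 0) :
    deriv Real.smoothTransition x = 0 := by
  have h : Real.smoothTransition =ᶠ[𝓝 x] fun _ => 0 := by
    filter_upwards [Iio_mem_nhds hx] with y hy
    exact Real.smoothTransition.zero_of_nonpos (le_of_lt hy)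
  rw [h.deriv_eq, deriv_const]

theorem deriv_smoothTransition_eq_zero_of_one_lt {x : ℝ} (hx : 1 < x) :
    deriv Real.smoothTransition x = 0 := by
  have h : Real.smoothTransition =ᶠ[𝓝 x] fun _ => 1 := by
    filter_upwards [Ioi_mem_nhds hx] with y hy
    exact Real.smoothTransition.one_of_one_le (le_of_lt hy)
  rw [h.deriv_eq, deriv_const]

theorem continuous_deriv_smoothTransition : Continuous (deriv Real.smoothTransition) :=
  (Real.smoothTransition.contDiff (n := 1)).continuous_deriv le_rfl

theorem exists_abs_deriv_smoothTransition_le :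
    ∃ C > 0, ∀ x, |deriv Real.smoothTransition x| ≤ C := by
  have hc : HasCompactSupport (deriv Real.smoothTransition) :=
    HasCompactSupport.intro (isCompact_Icc (a := (0 : ℝ)) (b := 1)) fun x hx => by
      rcases lt_or_ge x 0 with h | h
      · exact deriv_smoothTransition_eq_zero_of_neg h
      · exact deriv_smoothTransition_eq_zero_of_one_lt (by
          by_contra h1
          exact hx ⟨h, not_lt.1 h1⟩)
  obtain ⟨C, hC⟩ := hc.exists_bound_of_continuous continuous_deriv_smoothTransition
  exact ⟨max C 1, by positivity, fun x => (hC x).trans (le_max_left _ _)⟩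

/-- The truncation at height `N` of `g`, cut off near the origin at scale `1 / N`. -/
def poleTrunc {n : ℕ} (g : Euc n → ℝ) (N : ℝ) (x : Euc n) : ℝ :=
  Real.smoothTransition (N ^ 2 * ‖x‖ ^ 2 - 1) * (N * g x / (N + g x))

theorem hasFDerivAt_norm_sub_sq {n : ℕ} (x₀ x : Euc n) :
    HasFDerivAt (fun y => ‖y - x₀‖ ^ 2) (2 • innerSL ℝ (x - x₀)) x := by
  have h := ((hasFDerivAt_id x).sub_const x₀).norm_sq
  simpa using h

theorem fderiv_poleTrunc {n : ℕ} {g : Euc n → ℝ} {N : ℝ} (hN : 0 < N) {x : Euc n}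
    (hx : 0 < g x) (hd : DifferentiableAt ℝ g x) (v : Euc n) :
    fderiv ℝ (poleTrunc g N) x v =
      deriv Real.smoothTransition (N ^ 2 * ‖x‖ ^ 2 - 1) * (2 * N ^ 2 * ⟪x, v⟫)
        * (N * g x / (N + g x)) +
      Real.smoothTransition (N ^ 2 * ‖x‖ ^ 2 - 1) * (N ^ 2 / (N + g x) ^ 2) * fderiv ℝ g x v := by
  have hne : N + g x ≠ 0 := by positivity
  have h1 : HasFDerivAt (fun y : Euc n => N ^ 2 * ‖y‖ ^ 2 - 1)
      (N ^ 2 • (2 • innerSL ℝ x)) x := by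
    have := hasFDerivAt_norm_sub_sq (0 : Euc n) x
    simp only [sub_zero] at this
    exact (this.const_mul (N ^ 2)).sub_const 1
  have h2 := ((Real.smoothTransition.contDiff (n := 1)).differentiable one_ne_zero
    (N ^ 2 * ‖x‖ ^ 2 - 1)).hasDerivAt.comp_hasFDerivAt x h1
  have h3 : HasDerivAt (fun s : ℝ => N * s / (N + s)) (N ^ 2 / (N + g x) ^ 2) (g x) := by
    have := ((hasDerivAt_id (g x)).const_mul N).div ((hasDerivAt_id (g x)).const_add N) hne
    refine this.congr_deriv ?_
    simp
    ring
  have h4 := h3.comp_hasFDerivAt x hd.hasFDerivAt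
  have h5 := (h2.mul h4).fderiv
  have h6 : poleTrunc g N = (Real.smoothTransition ∘ fun y : Euc n => N ^ 2 * ‖y‖ ^ 2 - 1) *
    ((fun s : ℝ => N * s / (N + s)) ∘ g) := by
    ext y; simp [poleTrunc]
  rw [h6, h5]
  simp
  ring

theorem contDiffOn_poleTrunc {n : ℕ} {g : Euc n → ℝ} {N : ℝ} (hN : 0 < N) {s : Set (Euc n)}
    (hpos : ∀ x ∈ s, 0 < g x) (hg : ContDiffOn ℝ 1 g s) : ContDiffOn ℝ 1 (poleTrunc g N) s := by
  unfold poleTrunc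
  refine ContDiffOn.mul ?_ ?_
  · refine ((Real.smoothTransition.contDiff (n := 1)).comp ?_).contDiffOn
    exact (contDiff_const.mul (contDiff_norm_sq ℝ)).sub contDiff_const
  · refine (contDiffOn_const.mul hg).div (contDiffOn_const.add hg) fun x hx => ?_
    have := hpos x hx
    positivity

theorem contDiff_poleTrunc_smul {n : ℕ} {g : Euc n → ℝ} {N : ℝ} (hN : 0 < N) {V : Euc n → Euc n}
    {Ω : Set (Euc n)} (hΩ : IsOpen Ω)
    (hpos : ∀ x ∈ Ω \ {0}, 0 < g x) (hg : ContDiffOn ℝ 1 g (Ω \ {0}))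
    (hV : ContDiff ℝ 1 V) (hs : tsupport V ⊆ Ω) :
    ContDiff ℝ 1 fun x => poleTrunc g N x • V x := by
  rw [contDiff_iff_contDiffAt]
  intro x
  by_cases hx : x ∈ tsupport V
  · by_cases h0 : x = 0
    · have : (fun x => poleTrunc g N x • V x) =ᶠ[𝓝 x] fun _ => 0 := by
        have hU : {y : Euc n | N ^ 2 * ‖y‖ ^ 2 - 1 < 0} ∈ 𝓝 x := by
          refine IsOpen.mem_nhds (isOpen_lt (by fun_prop) continuous_const) ?_
          simp [h0]
        filter_upwards [hU] with y hy
        simp [poleTrunc, Real.smoothTransition.zero_of_nonpos (le_of_lt hy)]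
      exact contDiffAt_const.congr_of_eventuallyEq this
    · exact ((contDiffOn_poleTrunc hN hpos hg).contDiffAt
        ((hΩ.sdiff isClosed_singleton).mem_nhds ⟨hs hx, h0⟩)).smul hV.contDiffAt
  · have : (fun x => poleTrunc g N x • V x) =ᶠ[𝓝 x] fun _ => 0 := by
      filter_upwards [(isClosed_tsupport V).isOpen_compl.mem_nhds hx] with y hy
      simp [image_eq_zero_of_notMem_tsupport hy]
    exact contDiffAt_const.congr_of_eventuallyEq this

theorem volume_real_closedBall_zero {n : ℕ} (x : Euc n) {r : ℝ} (hr : 0 ≤ r) :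
    volume.real (closedBall x r) = r ^ n * volume.real (ball (0 : Euc n) 1) := by
  rw [Measure.addHaar_real_closedBall _ _ hr]
  simp

set_option maxHeartbeats 400000 in
/-- Integration by parts against a `C¹` vector field compactly supported in the open set `Ω`, for
a positive function which is `C¹` off the origin and integrable together with its gradient. -/
theorem integral_inner_gradient_add_mul_divg {n : ℕ} (hn : 3 ≤ n) {g : Euc n → ℝ}
    {V : Euc n → Euc n} {Ω : Set (Euc n)} (hΩ : IsOpen Ω)
    (hpos : ∀ x ∈ Ω \ {0}, 0 < g x) (hg : ContDiffOn ℝ 1 g (Ω \ {0}))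
    (hint : IntegrableOn g Ω) (hint' : IntegrableOn (fun x => ‖gradient g x‖) Ω)
    (hV : ContDiff ℝ 1 V) (hc : HasCompactSupport V) (hs : tsupport V ⊆ Ω) :
    ∫ x in Ω \ {0}, (⟪gradient g x, V x⟫ + g x * divg V x) = 0 := by
  set S : Set (Euc n) := Ω \ {0} with hS
  have hSo : IsOpen S := hΩ.sdiff isClosed_singleton
  have hSm : MeasurableSet S := hSo.measurableSet
  have hnt : Nontrivial (Euc n) := by
    have : Nonempty (Fin n) := ⟨⟨0, by omega⟩⟩
    infer_instance
  have hSae : S =ᵐ[volume] Ω := sdiff_null_ae_eq_self (measure_singleton 0)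
  have hintS : IntegrableOn g S := hint.mono_set sdiff_subset
  have hintS' : IntegrableOn (fun x => ‖gradient g x‖) S := hint'.mono_set sdiff_subset
  have hdiff : ∀ x ∈ S, DifferentiableAt ℝ g x := fun x hx =>
    (hg.contDiffAt (hSo.mem_nhds hx)).differentiableAt one_ne_zero
  have hgc : ContinuousOn g S := hg.continuousOn
  have hgradc : ContinuousOn (fun x => fderiv ℝ g x) S := hg.continuousOn_fderiv_of_isOpen hSo le_rfl
  have hVc : Continuous V := hV.continuous
  have hdVc : Continuous (divg V) := continuous_divg hV
  obtain ⟨C, hC0, hC⟩ := exists_abs_deriv_smoothTransition_le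
  obtain ⟨K, hK⟩ := hc.exists_bound_of_continuous hVc
  obtain ⟨D, hD⟩ := (hasCompactSupport_divg hc).exists_bound_of_continuous hdVc
  have hK0 : 0 ≤ K := (norm_nonneg _).trans (hK 0)
  set τ : ℝ → Euc n → ℝ := fun N x => Real.smoothTransition (N ^ 2 * ‖x‖ ^ 2 - 1) with hτ
  set a : ℝ → Euc n → ℝ := fun N x =>
    deriv Real.smoothTransition (N ^ 2 * ‖x‖ ^ 2 - 1) * (2 * N ^ 2 * ⟪x, V x⟫)
        * (N * g x / (N + g x)) with ha
  set b : ℝ → Euc n → ℝ := fun N x =>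
    τ N x * (N ^ 2 / (N + g x) ^ 2) * fderiv ℝ g x (V x) +
      τ N x * (N * g x / (N + g x)) * divg V x with hb
  have hsc : Continuous Real.smoothTransition := Real.smoothTransition.continuous
  have hdsc := continuous_deriv_smoothTransition
  have hden : ∀ N : ℝ, 0 < N → ∀ x ∈ S, N + g x ≠ 0 := fun N hN x hx => by
    have := hpos x hx
    positivity
  have hac : ∀ N : ℝ, 0 < N → ContinuousOn (a N) S := fun N hN => by
    have := hden N hN
    have h1 : ContinuousOn (fun x => N * g x / (N + g x)) S :=
      (continuousOn_const.mul hgc).div (continuousOn_const.add hgc) this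
    have h2 : Continuous fun x : Euc n =>
      deriv Real.smoothTransition (N ^ 2 * ‖x‖ ^ 2 - 1) * (2 * N ^ 2 * ⟪x, V x⟫) := by fun_prop
    exact h2.continuousOn.mul h1
  have hbc : ∀ N : ℝ, 0 < N → ContinuousOn (b N) S := fun N hN => by
    have := hden N hN
    have h1 : ContinuousOn (fun x => N * g x / (N + g x)) S :=
      (continuousOn_const.mul hgc).div (continuousOn_const.add hgc) this
    have h2 : ContinuousOn (fun x => N ^ 2 / (N + g x) ^ 2) S :=
      continuousOn_const.div ((continuousOn_const.add hgc).pow 2) fun x hx =>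
        pow_ne_zero 2 (this x hx)
    have h3 : Continuous (τ N) := by fun_prop
    have h4 : ContinuousOn (fun x => fderiv ℝ g x (V x)) S := hgradc.clm_apply hVc.continuousOn
    exact ((h3.continuousOn.mul h2).mul h4).add ((h3.continuousOn.mul h1).mul hdVc.continuousOn)
  have hq : ∀ N : ℝ, 0 < N → ∀ x ∈ S, 0 ≤ N * g x / (N + g x) ∧ N * g x / (N + g x) ≤ N ∧
      N * g x / (N + g x) ≤ g x ∧ 0 ≤ N ^ 2 / (N + g x) ^ 2 ∧ N ^ 2 / (N + g x) ^ 2 ≤ 1 := by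
    intro N hN x hx
    have hgx := hpos x hx
    refine ⟨by positivity, ?_, ?_, by positivity, ?_⟩
    · rw [div_le_iff₀ (by positivity)]; nlinarith
    · rw [div_le_iff₀ (by positivity)]; nlinarith
    · rw [div_le_one (by positivity)]; gcongr; linarith
  have hτ0 : ∀ N x, 0 ≤ τ N x := fun N x => Real.smoothTransition.nonneg _
  have hτ1 : ∀ N x, τ N x ≤ 1 := fun N x => Real.smoothTransition.le_one _
  have hfd : ∀ x, |fderiv ℝ g x (V x)| ≤ ‖gradient g x‖ * K := fun x => by
    rw [← inner_gradient_eq_fderiv]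
    exact (abs_real_inner_le_norm _ _).trans (by gcongr; exact hK x)
  have hbbound : ∀ N : ℝ, 0 < N → ∀ x ∈ S, ‖b N x‖ ≤ ‖gradient g x‖ * K + g x * D := by
    intro N hN x hx
    obtain ⟨h1, h2, h3, h4, h5⟩ := hq N hN x hx
    have hgx := hpos x hx
    refine (norm_add_le _ _).trans (add_le_add ?_ ?_)
    · rw [norm_mul, Real.norm_eq_abs, Real.norm_eq_abs,
        abs_of_nonneg (mul_nonneg (hτ0 N x) h4)]
      have : τ N x * (N ^ 2 / (N + g x) ^ 2) ≤ 1 := mul_le_one₀ (hτ1 N x) h4 h5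
      calc _ ≤ 1 * |fderiv ℝ g x (V x)| := by gcongr
        _ ≤ _ := by rw [one_mul]; exact hfd x
    · rw [norm_mul, Real.norm_eq_abs, abs_of_nonneg (mul_nonneg (hτ0 N x) h1)]
      have : τ N x * (N * g x / (N + g x)) ≤ 1 * g x :=
        mul_le_mul (hτ1 N x) h3 h1 zero_le_one
      rw [one_mul] at this
      exact mul_le_mul this (hD x) (norm_nonneg _) hgx.le
  have hbdom : IntegrableOn (fun x => ‖gradient g x‖ * K + g x * D) S :=
    (hintS'.mul_const K).add (hintS.mul_const D)
  have habound : ∀ N : ℝ, 0 < N → ∀ x ∈ S,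
      ‖a N x‖ ≤ (closedBall (0 : Euc n) (2 / N)).indicator (fun _ => 4 * C * K * N ^ 2) x := by
    intro N hN x hx
    obtain ⟨h1, h2, -⟩ := hq N hN x hx
    by_cases hxN : x ∈ closedBall (0 : Euc n) (2 / N)
    · rw [indicator_of_mem hxN]
      have hxn : ‖x‖ ≤ 2 / N := by simpa using hxN
      rw [ha]
      simp only [norm_mul, Real.norm_eq_abs]
      rw [abs_of_nonneg h1]
      have h3 : |⟪x, V x⟫| ≤ 2 / N * K :=
        (abs_real_inner_le_norm _ _).trans (by gcongr; exact hK x)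
      have h4 : |(2 : ℝ)| * |N ^ 2| * |⟪x, V x⟫| ≤ 2 * N ^ 2 * (2 / N * K) := by
        rw [abs_two, abs_of_nonneg (sq_nonneg N)]
        gcongr
      calc _ ≤ C * (2 * N ^ 2 * (2 / N * K)) * N := by
            gcongr
            exact hC _
        _ = _ := by field_simp; ring
    · rw [indicator_of_notMem hxN]
      have hxn : 2 / N < ‖x‖ := by simpa using hxN
      have h3 : 1 < N ^ 2 * ‖x‖ ^ 2 - 1 := by
        rw [div_lt_iff₀ hN] at hxn
        nlinarith
      simp [ha, deriv_smoothTransition_eq_zero_of_one_lt h3]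
  have hind : ∀ N : ℝ, Integrable
      ((closedBall (0 : Euc n) (2 / N)).indicator fun _ => 4 * C * K * N ^ 2) := fun N => by
    rw [integrable_indicator_iff measurableSet_closedBall]
    exact integrableOn_const (measure_closedBall_lt_top).ne
  have haint : ∀ N : ℝ, 0 < N → IntegrableOn (a N) S := fun N hN =>
    Integrable.mono' (hind N).integrableOn ((hac N hN).aestronglyMeasurable hSm)
      ((ae_restrict_iff' hSm).2 (ae_of_all _ (habound N hN)))
  have hbint : ∀ N : ℝ, 0 < N → IntegrableOn (b N) S := fun N hN =>
    Integrable.mono' hbdom ((hbc N hN).aestronglyMeasurable hSm)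
      ((ae_restrict_iff' hSm).2 (ae_of_all _ (hbbound N hN)))
  have hzero : ∀ N : ℝ, 0 < N → ∫ x in S, b N x = - ∫ x in S, a N x := by
    intro N hN
    have hF := contDiff_poleTrunc_smul hN hΩ hpos hg hV hs
    have hFc : HasCompactSupport fun x => poleTrunc g N x • V x :=
      HasCompactSupport.intro hc fun x hx => by simp [image_eq_zero_of_notMem_tsupport hx]
    have hsub : tsupport (fun x => poleTrunc g N x • V x) ⊆ tsupport V := by
      refine closure_mono fun y hy => ?_
      contrapose! hy
      simp [Function.notMem_support.1 hy]
    have hFs : ∀ x ∉ Ω, divg (fun x => poleTrunc g N x • V x) x = 0 := fun x hx =>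
      divg_eq_zero_of_notMem_tsupport fun h =>
        hx (hs (hsub h))
    have h0 := integral_divg_eq_zero hF hFc
    rw [← setIntegral_eq_integral_of_forall_compl_eq_zero hFs, ← setIntegral_congr_set hSae,
      setIntegral_congr_fun (g := fun x => a N x + b N x) hSm, integral_add (haint N hN)
      (hbint N hN)] at h0
    · linarith
    · intro x hx
      have hT : DifferentiableAt ℝ (poleTrunc g N) x :=
        ((contDiffOn_poleTrunc hN hpos hg).contDiffAt (hSo.mem_nhds hx)).differentiableAt
          one_ne_zero
      show divg (fun x => poleTrunc g N x • V x) x = a N x + b N x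
      rw [divg_smul hT (hV.differentiable one_ne_zero x),
        fderiv_poleTrunc hN (hpos x hx) (hdiff x hx)]
      simp only [ha, hb, hτ, poleTrunc]
      ring
  have hlim1 : Tendsto (fun k : ℕ => ∫ x in S, b ((k : ℝ) + 1) x) atTop
      (𝓝 (∫ x in S, (⟪gradient g x, V x⟫ + g x * divg V x))) := by
    refine tendsto_integral_of_dominated_convergence _
      (fun k => (hbc _ (by positivity)).aestronglyMeasurable hSm) hbdom
      (fun k => (ae_restrict_iff' hSm).2 (ae_of_all _ (hbbound _ (by positivity)))) ?_
    refine (ae_restrict_iff' hSm).2 (ae_of_all _ fun x hx => ?_)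
    have hx0 : 0 < ‖x‖ := norm_pos_iff.2 hx.2
    have hgx := hpos x hx
    have hNt : Tendsto (fun k : ℕ => (k : ℝ) + 1) atTop atTop :=
      tendsto_atTop_add_const_right _ _ tendsto_natCast_atTop_atTop
    have hr : Tendsto (fun k : ℕ => ((k : ℝ) + 1) / (((k : ℝ) + 1) + g x)) atTop (𝓝 1) := by
      have h1 : Tendsto (fun k : ℕ => 1 - g x / (((k : ℝ) + 1) + g x)) atTop (𝓝 (1 - 0)) :=
        tendsto_const_nhds.sub
          (tendsto_const_nhds.div_atTop (tendsto_atTop_add_const_right _ _ hNt))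
      rw [sub_zero] at h1
      refine h1.congr fun k => ?_
      have : (k : ℝ) + 1 + g x ≠ 0 := by positivity
      field_simp
      ring
    have hτe : ∀ᶠ k : ℕ in atTop, τ ((k : ℝ) + 1) x = 1 := by
      filter_upwards [hNt.eventually_ge_atTop (2 / ‖x‖)] with k hk
      refine Real.smoothTransition.one_of_one_le ?_
      rw [div_le_iff₀ hx0] at hk
      nlinarith
    have h2 : Tendsto (fun k : ℕ =>
        1 * (((k : ℝ) + 1) / (((k : ℝ) + 1) + g x)) ^ 2 * fderiv ℝ g x (V x) +
        1 * ((((k : ℝ) + 1) / (((k : ℝ) + 1) + g x)) * g x) * divg V x) atTop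
        (𝓝 (1 * 1 ^ 2 * fderiv ℝ g x (V x) + 1 * (1 * g x) * divg V x)) :=
      ((tendsto_const_nhds.mul (hr.pow 2)).mul_const _).add
        ((tendsto_const_nhds.mul (hr.mul_const _)).mul_const _)
    have h3 : 1 * 1 ^ 2 * fderiv ℝ g x (V x) + 1 * (1 * g x) * divg V x =
        ⟪gradient g x, V x⟫ + g x * divg V x := by
      rw [inner_gradient_eq_fderiv]; ring
    rw [h3] at h2
    refine h2.congr' ?_
    filter_upwards [hτe] with k hk
    simp only [hb, hk]
    rw [div_pow, div_mul_eq_mul_div]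
  have hlim2 : Tendsto (fun k : ℕ => ∫ x in S, b ((k : ℝ) + 1) x) atTop (𝓝 0) := by
    set W := volume.real (ball (0 : Euc n) 1)
    have hbd : ∀ k : ℕ, ‖∫ x in S, b ((k : ℝ) + 1) x‖ ≤
        (4 * C * K * 2 ^ n * W) * (1 / ((k : ℝ) + 1)) := by
      intro k
      have hN : (0 : ℝ) < (k : ℝ) + 1 := by positivity
      rw [hzero _ hN, norm_neg]
      refine (norm_integral_le_of_norm_le (hind _).integrableOn
        ((ae_restrict_iff' hSm).2 (ae_of_all _ (habound _ hN)))).trans ?_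
      refine (setIntegral_le_integral (hind _) (ae_of_all _ fun x =>
        indicator_nonneg (fun _ _ => by positivity) x)).trans ?_
      rw [integral_indicator_const _ measurableSet_closedBall,
        volume_real_closedBall_zero _ (by positivity), smul_eq_mul, div_pow]
      have h1 : (1 : ℝ) ≤ (k : ℝ) + 1 := by simp
      have h2 : ((k : ℝ) + 1) ^ 3 ≤ ((k : ℝ) + 1) ^ n := pow_le_pow_right₀ h1 hn
      have h3 : 2 ^ n / ((k : ℝ) + 1) ^ n ≤ 2 ^ n / ((k : ℝ) + 1) ^ 3 := by gcongr
      calc _ ≤ 2 ^ n / ((k : ℝ) + 1) ^ 3 * W * (4 * C * K * ((k : ℝ) + 1) ^ 2) := by gcongr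
        _ = _ := by field_simp
    refine squeeze_zero_norm hbd ?_
    simpa using (tendsto_one_div_add_atTop_nhds_zero_nat (𝕜 := ℝ)).const_mul
      (4 * C * K * 2 ^ n * W)
  exact tendsto_nhds_unique hlim1 hlim2

theorem hasDerivAt_integral_left_of_contDiffOn {p : ℝ → ℝ} {a b u : ℝ}
    (hp : ContinuousOn p (Ioi a)) (hb : a < b) (hu : a < u) :
    HasDerivAt (fun v => ∫ t in v..b, p t) (-p u) u := by
  refine intervalIntegral.integral_hasDerivAt_left ?_ ?_ (hp.continuousAt (Ioi_mem_nhds hu))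
  · refine (hp.mono fun t ht => ?_).intervalIntegrable
    exact (lt_min hu hb).trans_le ht.1
  · exact hp.stronglyMeasurableAtFilter isOpen_Ioi u hu

theorem contDiffOn_integral_left {p : ℝ → ℝ} {a b : ℝ}
    (hp : ContDiffOn ℝ (⊤ : ℕ∞) p (Ioi a)) (hb : a < b) :
    ContDiffOn ℝ (⊤ : ℕ∞) (fun v => ∫ t in v..b, p t) (Ioi a) := by
  have hd := fun u hu => hasDerivAt_integral_left_of_contDiffOn (u := u) hp.continuousOn hb hu
  rw [contDiffOn_infty_iff_deriv_of_isOpen isOpen_Ioi]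
  exact ⟨fun u hu => (hd u hu).differentiableAt.differentiableWithinAt,
    hp.neg.congr fun u hu => (hd u hu).deriv⟩

/-- The result of applying (minus) the principal part and the drift part of the operator to a radial
function of `x - x₀` whose profile, as a function of `‖x - x₀‖²`, has derivative `-p`. -/
def radialOp {n : ℕ} (B : Euc n → Euc n) (x₀ : Euc n) (p : ℝ → ℝ) (x : Euc n) : ℝ :=
  4 * ‖x - x₀‖ ^ 2 * deriv p (‖x - x₀‖ ^ 2) + 2 * n * p (‖x - x₀‖ ^ 2) +
    2 * p (‖x - x₀‖ ^ 2) * ⟪B x, x - x₀⟫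

theorem integrableOn_mul_of_continuousOn {n : ℕ} {g J : Euc n → ℝ} {S : Set (Euc n)}
    (hS : MeasurableSet S) (hg : ContinuousOn g S) (hint : IntegrableOn g S)
    (hJ : ContinuousOn J S) {D : ℝ} (hD : ∀ x ∈ S, |J x| ≤ D) :
    IntegrableOn (fun x => g x * J x) S := by
  refine Integrable.mono' (hint.norm.mul_const D) ((hg.mul hJ).aestronglyMeasurable hS)
    ((ae_restrict_iff' hS).2 (ae_of_all _ fun x hx => ?_))
  rw [norm_mul]
  exact mul_le_mul_of_nonneg_left (hD x hx) (norm_nonneg _)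

theorem integral_mul_radialOp_le {n : ℕ} (hn : 3 ≤ n) {B : Euc n → Euc n} {g : Euc n → ℝ}
    (hB : ContDiffOn ℝ 1 B (ball 0 1)) (hdiv : ∀ x ∈ ball (0 : Euc n) 1, divg B x ≤ 0)
    (hg : IsGreenPole B 0 g) (x₀ : Euc n) {p : ℝ → ℝ} {a R : ℝ} (ha : a < 0)
    (hp : ContDiffOn ℝ (⊤ : ℕ∞) p (Ioi a)) (hp0 : ∀ u, 0 ≤ u → 0 ≤ p u) (hR : 0 < R)
    (hpR : ∀ u, R ^ 2 ≤ u → p u = 0) (hball : closedBall x₀ R ⊆ ball 0 1) :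
    IntegrableOn (fun x => g x * radialOp B x₀ p x) (ball 0 1 \ {0}) ∧
      ∫ x in ball 0 1 \ {0}, g x * radialOp B x₀ p x ≤ ∫ t in ‖x₀‖ ^ 2..R ^ 2, p t := by
  obtain ⟨hpos, hg3, hint, hint', -, hweak⟩ := hg
  set S : Set (Euc n) := ball 0 1 \ {0} with hS
  have hSo : IsOpen S := isOpen_ball.sdiff isClosed_singleton
  have hSm : MeasurableSet S := hSo.measurableSet
  have hnt : Nontrivial (Euc n) := by
    have : Nonempty (Fin n) := ⟨⟨0, by omega⟩⟩
    infer_instance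
  have hSae : S =ᵐ[volume] ball (0 : Euc n) 1 := sdiff_null_ae_eq_self (measure_singleton 0)
  have hg1 : ContDiffOn ℝ 1 g S := hg3.of_le (by norm_num)
  have hpos' : ∀ x ∈ S, 0 < g x := fun x hx => hpos x hx.1 hx.2
  have haR : a < R ^ 2 := ha.trans (by positivity)
  set Ψ : ℝ → ℝ := fun v => ∫ t in v..R ^ 2, p t with hΨ
  have hΨs : ContDiffOn ℝ (⊤ : ℕ∞) Ψ (Ioi a) := contDiffOn_integral_left hp haR
  have hΨd : ∀ u, a < u → HasDerivAt Ψ (-p u) u := fun u hu =>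
    hasDerivAt_integral_left_of_contDiffOn hp.continuousOn haR hu
  have hΨ0 : ∀ u, R ^ 2 ≤ u → Ψ u = 0 := fun u hu => by
    rw [hΨ]
    refine (intervalIntegral.integral_congr (g := fun _ => (0 : ℝ)) fun t ht => ?_).trans (by simp)
    rw [uIcc_of_ge hu] at ht
    exact hpR t ht.1
  have hΨnn : ∀ u, 0 ≤ u → 0 ≤ Ψ u := fun u hu => by
    rcases le_total (R ^ 2) u with h | h
    · rw [hΨ0 u h]
    · exact intervalIntegral.integral_nonneg h fun t ht => hp0 t (hu.trans ht.1)
  set s : Euc n → ℝ := fun x => ‖x - x₀‖ ^ 2 with hs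
  have hs0 : ∀ x, a < s x := fun x => ha.trans_le (sq_nonneg _)
  have hss : ContDiff ℝ (⊤ : ℕ∞) s := (contDiff_id.sub contDiff_const).norm_sq ℝ
  have hps : ContDiff ℝ (⊤ : ℕ∞) (fun x => p (s x)) := by
    rw [← contDiffOn_univ]
    exact hp.comp hss.contDiffOn fun x _ => hs0 x
  set φ : Euc n → ℝ := fun x => Ψ (s x) with hφ
  have hφs : ContDiff ℝ (⊤ : ℕ∞) φ := by
    rw [← contDiffOn_univ]
    exact hΨs.comp hss.contDiffOn fun x _ => hs0 x
  have hout : ∀ x ∉ closedBall x₀ R, R ^ 2 ≤ s x := fun x hx => by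
    rw [mem_closedBall, dist_eq_norm, not_le] at hx
    exact pow_le_pow_left₀ hR.le hx.le 2
  have hφ0 : ∀ x ∉ closedBall x₀ R, φ x = 0 := fun x hx => hΨ0 _ (hout x hx)
  have hφc : HasCompactSupport φ := HasCompactSupport.intro (isCompact_closedBall x₀ R) hφ0
  have hφt : tsupport φ ⊆ closedBall x₀ R := closure_minimal
    (fun x hx => by by_contra h; exact hx (hφ0 x h)) isClosed_closedBall
  have hφd : ∀ x, HasFDerivAt φ ((-p (s x)) • (2 • innerSL ℝ (x - x₀))) x := fun x =>
    (hΨd _ (hs0 x)).comp_hasFDerivAt x (hasFDerivAt_norm_sub_sq x₀ x)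
  set V : Euc n → Euc n := fun x => φ x • B x + (-2 * p (s x)) • (x - x₀) with hV
  have hV0 : ∀ x ∉ closedBall x₀ R, V x = 0 := fun x hx => by
    simp [hV, hφ0 x hx, hpR _ (hout x hx)]
  have hVc : HasCompactSupport V := HasCompactSupport.intro (isCompact_closedBall x₀ R) hV0
  have hVt : tsupport V ⊆ closedBall x₀ R := closure_minimal
    (fun x hx => by by_contra h; exact hx (hV0 x h)) isClosed_closedBall
  have h1le : ((1 : ℕ∞) : WithTop ℕ∞) ≤ ((⊤ : ℕ∞) : WithTop ℕ∞) := by exact_mod_cast le_top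
  have hφ1 : ContDiff ℝ 1 φ := hφs.of_le h1le
  have hp1 : ContDiff ℝ 1 (fun x => -2 * p (s x)) := contDiff_const.mul (hps.of_le h1le)
  have hVs : ContDiff ℝ 1 V := by
    rw [contDiff_iff_contDiffAt]
    intro x
    by_cases hx : x ∈ closedBall x₀ R
    · exact (hφ1.contDiffAt.smul (hB.contDiffAt (isOpen_ball.mem_nhds (hball hx)))).add
        (hp1.contDiffAt.smul (contDiffAt_id.sub contDiffAt_const))
    · refine (contDiffAt_const (c := (0 : Euc n))).congr_of_eventuallyEq ?_
      filter_upwards [isClosed_closedBall.isOpen_compl.mem_nhds hx] with y hy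
      exact hV0 y hy
  have hibp := integral_inner_gradient_add_mul_divg hn isOpen_ball hpos' hg1 hint hint' hVs hVc
    (hVt.trans hball)
  have hw := hweak φ hφs hφc (hφt.trans hball)
  have hgradφ : ∀ x v, ⟪v, gradient φ x⟫ = -2 * p (s x) * ⟪x - x₀, v⟫ := fun x v => by
    rw [real_inner_comm, inner_gradient_eq_fderiv, (hφd x).fderiv]
    simp [inner_sub_left]
    ring
  have hwV : ∫ x in S, ⟪gradient g x, V x⟫ = φ 0 := by
    rw [← hw, setIntegral_congr_set hSae]
    refine integral_congr_ae (ae_of_all _ fun x => ?_)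
    simp only [hgradφ, hV, inner_add_right, inner_smul_right]
    rw [real_inner_comm (B x), real_inner_comm (x - x₀)]
    ring
  have hintS : IntegrableOn g S := hint.mono_set sdiff_subset
  have hintS' : IntegrableOn (fun x => ‖gradient g x‖) S := hint'.mono_set sdiff_subset
  have hgc : ContinuousOn g S := hg1.continuousOn
  obtain ⟨D, hD⟩ := (hasCompactSupport_divg hVc).exists_bound_of_continuous (continuous_divg hVs)
  obtain ⟨K, hK⟩ := hVc.exists_bound_of_continuous hVs.continuous
  have hi1 : IntegrableOn (fun x => g x * divg V x) S :=
    integrableOn_mul_of_continuousOn hSm hgc hintS (continuous_divg hVs).continuousOn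
      fun x _ => hD x
  have hi2 : IntegrableOn (fun x => ⟪gradient g x, V x⟫) S := by
    have hc : ContinuousOn (fun x => ⟪gradient g x, V x⟫) S := by
      simp only [inner_gradient_eq_fderiv]
      exact (hg1.continuousOn_fderiv_of_isOpen hSo le_rfl).clm_apply hVs.continuous.continuousOn
    refine Integrable.mono' (hintS'.mul_const K) (hc.aestronglyMeasurable hSm)
      (ae_of_all _ fun x => ?_)
    exact (abs_real_inner_le_norm _ _).trans (by gcongr; exact hK x)
  rw [integral_add hi2 hi1, hwV] at hibp
  have hdivV : ∀ x ∈ ball (0 : Euc n) 1,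
      divg V x = φ x * divg B x - radialOp B x₀ p x := fun x hx => by
    have hBd : DifferentiableAt ℝ B x :=
      (hB.contDiffAt (isOpen_ball.mem_nhds hx)).differentiableAt one_ne_zero
    have hφd' := (hφd x).differentiableAt
    have hpd : HasFDerivAt (fun y => -2 * p (s y))
        ((-2 : ℝ) • (deriv p (s x) • (2 • innerSL ℝ (x - x₀)))) x := by
      have h1 : HasDerivAt p (deriv p (s x)) (s x) :=
        ((hp.contDiffAt (Ioi_mem_nhds (hs0 x))).differentiableAt (by simp)).hasDerivAt
      exact (h1.comp_hasFDerivAt x (hasFDerivAt_norm_sub_sq x₀ x)).const_mul (-2)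
    have hid : DifferentiableAt ℝ (fun y : Euc n => y - x₀) x := by fun_prop
    rw [hV, divg_add (F := fun y => φ y • B y) (G := fun y => (-2 * p (s y)) • (y - x₀))
      (hφd'.smul hBd) (hpd.differentiableAt.smul hid), divg_smul hφd' hBd, divg_smul hpd.differentiableAt hid, divg_sub_const, (hφd x).fderiv,
      hpd.fderiv]
    have e1 : ⟪x, x - x₀⟫ - ⟪x₀, x - x₀⟫ = ‖x - x₀‖ ^ 2 := by
      rw [← inner_sub_left, real_inner_self_eq_norm_sq]
    have e2 : ⟪B x, x - x₀⟫ = ⟪x, B x⟫ - ⟪x₀, B x⟫ := by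
      rw [real_inner_comm, inner_sub_left]
    simp only [radialOp, hs, e2]
    simp
    linear_combination -4 * deriv p (‖x - x₀‖ ^ 2) * e1
  have hJc : ContinuousOn (radialOp B x₀ p) (ball 0 1) := by
    have h1 : Continuous fun x => deriv p (s x) := by
      rw [← continuousOn_univ]
      exact (hp.continuousOn_deriv_of_isOpen isOpen_Ioi h1le).comp hss.continuous.continuousOn
        fun x _ => hs0 x
    have h2 := hps.continuous
    have h3 := hB.continuousOn
    have h4 := hss.continuous
    have h5 : ContinuousOn (fun x => ⟪B x, x - x₀⟫) (ball 0 1) :=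
      ContinuousOn.inner (𝕜 := ℝ) h3 (continuousOn_id.sub continuousOn_const)
    have h6 : Continuous fun x => 4 * s x * deriv p (s x) + 2 * n * p (s x) :=
      ((continuous_const.mul h4).mul h1).add (continuous_const.mul h2)
    have h7 : Continuous fun x => 2 * p (s x) := continuous_const.mul h2
    exact h6.continuousOn.add (h7.continuousOn.mul h5)
  obtain ⟨D', hD'⟩ := (isCompact_closedBall x₀ R).exists_bound_of_continuousOn (hJc.mono hball)
  have hD'' : ∀ x ∈ S, |radialOp B x₀ p x| ≤ D + |D'| := fun x hx => by
    have hD0 : 0 ≤ D := (norm_nonneg _).trans (hD x)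
    by_cases h : x ∈ closedBall x₀ R
    · exact (hD' x h).trans ((le_abs_self _).trans (by linarith))
    · have h1 := hdivV x hx.1
      rw [hφ0 x h, zero_mul, zero_sub] at h1
      have h2 := hD x
      rw [h1, norm_neg] at h2
      exact h2.trans (by simp)
  have hi3 := integrableOn_mul_of_continuousOn hSm hgc hintS (hJc.mono sdiff_subset) hD''
  refine ⟨hi3, ?_⟩
  have hφz : φ 0 = ∫ t in ‖x₀‖ ^ 2..R ^ 2, p t := by simp [hφ, hΨ, hs]
  rw [← hφz]
  calc ∫ x in S, g x * radialOp B x₀ p x ≤ ∫ x in S, -(g x * divg V x) := by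
        refine setIntegral_mono_on hi3 hi1.neg hSm fun x hx => ?_
        rw [← mul_neg, hdivV x hx.1]
        have h1 := hdiv x hx.1
        have h2 : 0 ≤ φ x := hΨnn _ (sq_nonneg _)
        have := hpos' x hx
        gcongr
        nlinarith
    _ = φ 0 := by rw [integral_neg]; linarith

/-- A lower bound on `radialOp` yields a comparison of integrals of the Green's function. -/
theorem mul_setIntegral_le_of_le_radialOp {n : ℕ} (hn : 3 ≤ n) {B : Euc n → Euc n} {g : Euc n → ℝ}
    (hB : ContDiffOn ℝ 1 B (ball 0 1)) (hdiv : ∀ x ∈ ball (0 : Euc n) 1, divg B x ≤ 0)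
    (hg : IsGreenPole B 0 g) (x₀ : Euc n) {p : ℝ → ℝ} {a R : ℝ} (ha : a < 0)
    (hp : ContDiffOn ℝ (⊤ : ℕ∞) p (Ioi a)) (hp0 : ∀ u, 0 ≤ u → 0 ≤ p u) (hR : 0 < R)
    (hpR : ∀ u, R ^ 2 ≤ u → p u = 0) (hball : closedBall x₀ R ⊆ ball 0 1)
    {S₁ S₂ : Set (Euc n)} (h₁ : MeasurableSet S₁) (h₂ : MeasurableSet S₂)
    (hs₁ : S₁ ⊆ ball 0 1) (hs₂ : S₂ ⊆ ball 0 1) {c₁ c₂ : ℝ}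
    (hle : ∀ x ∈ ball (0 : Euc n) 1,
      S₁.indicator (fun _ => c₁) x - S₂.indicator (fun _ => c₂) x ≤ radialOp B x₀ p x) :
    c₁ * ∫ x in S₁, g x ≤ (∫ t in ‖x₀‖ ^ 2..R ^ 2, p t) + c₂ * ∫ x in S₂, g x := by
  obtain ⟨hi, hle'⟩ := integral_mul_radialOp_le hn hB hdiv hg x₀ ha hp hp0 hR hpR hball
  obtain ⟨hpos, hg3, hint, -⟩ := hg
  set S : Set (Euc n) := ball 0 1 \ {0} with hS
  have hSm : MeasurableSet S := measurableSet_ball.diff (measurableSet_singleton _)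
  have hnt : Nontrivial (Euc n) := by
    have : Nonempty (Fin n) := ⟨⟨0, by omega⟩⟩
    infer_instance
  have hSae : S =ᵐ[volume] ball (0 : Euc n) 1 := sdiff_null_ae_eq_self (measure_singleton 0)
  have hintS : IntegrableOn g S := hint.mono_set sdiff_subset
  have key : ∀ {T : Set (Euc n)} (c : ℝ), MeasurableSet T → T ⊆ ball 0 1 →
      IntegrableOn (fun x => T.indicator (fun y => c * g y) x) S ∧
      ∫ x in S, T.indicator (fun y => c * g y) x = c * ∫ x in T, g x := fun {T} c hT hTs => by
    refine ⟨(hintS.const_mul c).indicator hT, ?_⟩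
    rw [setIntegral_congr_set hSae, setIntegral_indicator hT, inter_eq_right.2 hTs,
      integral_const_mul]
  obtain ⟨hj₁, he₁⟩ := key c₁ h₁ hs₁
  obtain ⟨hj₂, he₂⟩ := key c₂ h₂ hs₂
  rw [← he₁, ← he₂]
  have : ∫ x in S, (S₁.indicator (fun y => c₁ * g y) x - S₂.indicator (fun y => c₂ * g y) x) ≤
      ∫ x in S, g x * radialOp B x₀ p x := by
    refine setIntegral_mono_on (hj₁.sub hj₂) hi hSm fun x hx => ?_
    have hgx := hpos x hx.1 hx.2
    refine le_trans (le_of_eq ?_) (mul_le_mul_of_nonneg_left (hle x hx.1) hgx.le)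
    simp only [indicator]
    split_ifs <;> ring
  rw [integral_sub hj₁ hj₂] at this
  linarith

/-- Profile of a subsolution which concentrates at scale `ε`, for a drift bounded by `m`. -/
def poleProfile (n : ℕ) (m ε u : ℝ) : ℝ :=
  Real.exp (2 * m * √(ε ^ 2 + u)) / √(ε ^ 2 + u) ^ n

theorem hasDerivAt_poleProfile {n : ℕ} {m ε u : ℝ} (hu : 0 < ε ^ 2 + u) :
    HasDerivAt (poleProfile n m ε)
      (poleProfile n m ε u * (m / √(ε ^ 2 + u) - n / (2 * (ε ^ 2 + u)))) u := by
  have hw : 0 < √(ε ^ 2 + u) := Real.sqrt_pos.2 hu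
  have h1 : HasDerivAt (fun v => √(ε ^ 2 + v)) (1 / (2 * √(ε ^ 2 + u))) u :=
    ((hasDerivAt_id u).const_add (ε ^ 2)).sqrt hu.ne'
  have h2 := (h1.const_mul (2 * m)).exp.div (h1.pow n) (pow_pos hw n).ne'
  refine h2.congr_deriv ?_
  have h3 : (ε ^ 2 + u) = √(ε ^ 2 + u) ^ 2 := (Real.sq_sqrt hu.le).symm
  unfold poleProfile
  simp only [Pi.pow_apply]
  rw [show (n : ℝ) / (2 * (ε ^ 2 + u)) = n / (2 * √(ε ^ 2 + u) ^ 2) by rw [← h3]]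
  clear h1 h2 h3
  generalize √(ε ^ 2 + u) = w at *
  rcases n with _ | k
  · simp; field_simp
  · simp only [Nat.add_sub_cancel, pow_succ]
    field_simp

theorem contDiffOn_poleProfile {n : ℕ} {m ε : ℝ} {k : WithTop ℕ∞} :
    ContDiffOn ℝ k (poleProfile n m ε) (Ioi (-ε ^ 2)) := by
  have hw : ContDiffOn ℝ k (fun u => √(ε ^ 2 + u)) (Ioi (-ε ^ 2)) :=
    (contDiffOn_const.add contDiffOn_id).sqrt fun u hu => by
      have : -ε ^ 2 < u := hu
      simp only [id]
      linarith
  refine (contDiffOn_const.mul hw).exp.div (hw.pow n) fun u hu => ?_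
  have : -ε ^ 2 < u := hu
  exact (pow_pos (Real.sqrt_pos.2 (by linarith)) n).ne'

theorem poleProfile_bracket {n : ℕ} (hn : 3 ≤ n) {m ε u t : ℝ} (hm : 0 < m) (hε : 0 < ε)
    (hεm : m * ε ≤ 1) (hu : 0 ≤ u) (ht : |t| ≤ m * √u) :
    0 ≤ 4 * u * (m / √(ε ^ 2 + u) - n / (2 * (ε ^ 2 + u))) + 2 * n + 2 * t ∧
    (u ≤ ε ^ 2 → 1 ≤ 4 * u * (m / √(ε ^ 2 + u) - n / (2 * (ε ^ 2 + u))) + 2 * n + 2 * t) := by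
  have hn' : (3 : ℝ) ≤ n := by exact_mod_cast hn
  have hs : 0 < ε ^ 2 + u := by positivity
  have hw : 0 < √(ε ^ 2 + u) := Real.sqrt_pos.2 hs
  have ht' := neg_le_of_abs_le ht
  have h0 : 4 * u * (m / √(ε ^ 2 + u) - n / (2 * (ε ^ 2 + u))) + 2 * n + 2 * t =
      4 * m * (u / √(ε ^ 2 + u)) + 2 * n * (ε ^ 2 / (ε ^ 2 + u)) + 2 * t := by
    field_simp
    ring
  rw [h0]
  have h1 : 0 ≤ 4 * m * (u / √(ε ^ 2 + u)) := by positivity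
  have small : u ≤ ε ^ 2 →
      1 ≤ 4 * m * (u / √(ε ^ 2 + u)) + 2 * n * (ε ^ 2 / (ε ^ 2 + u)) + 2 * t := fun h => by
    have h2 : 1 / 2 ≤ ε ^ 2 / (ε ^ 2 + u) := by
      rw [div_le_div_iff₀ two_pos hs]; linarith
    have h3 : √u ≤ ε := Real.sqrt_le_iff.2 ⟨hε.le, h⟩
    have h4 : m * √u ≤ 1 := (mul_le_mul_of_nonneg_left h3 hm.le).trans hεm
    nlinarith
  refine ⟨?_, small⟩
  rcases le_total u (ε ^ 2) with h | h
  · exact zero_le_one.trans (small h)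
  · have hu0 : 0 < u := lt_of_lt_of_le (by positivity) h
    have h2 : √(ε ^ 2 + u) ≤ 2 * √u := by
      rw [Real.sqrt_le_iff]
      refine ⟨by positivity, ?_⟩
      rw [mul_pow, Real.sq_sqrt hu]
      linarith
    have h3 : √u / 2 ≤ u / √(ε ^ 2 + u) := by
      rw [div_le_div_iff₀ two_pos hw]
      nlinarith [Real.sq_sqrt hu, Real.sqrt_nonneg u]
    have h4 : 0 ≤ 2 * n * (ε ^ 2 / (ε ^ 2 + u)) := by positivity
    nlinarith

set_option maxHeartbeats 1000000 in
/-- Quantitative local boundedness of the Green's function away from its pole. -/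
theorem exists_green_mul_pow_le_setIntegral (n : ℕ) (hn : 3 ≤ n) {m : ℝ} (hm : 0 < m) :
    ∃ C > 0, ∀ (B : Euc n → Euc n) (g : Euc n → ℝ), ContDiffOn ℝ 1 B (ball 0 1) →
      (∀ x ∈ ball (0 : Euc n) 1, divg B x ≤ 0) → IsGreenPole B 0 g →
      ∀ (x₀ : Euc n) (ρ : ℝ), 0 < ρ → ρ ≤ 1 → ρ ≤ ‖x₀‖ → closedBall x₀ ρ ⊆ ball 0 1 →
      (∀ x ∈ closedBall x₀ ρ, ‖B x‖ ≤ m) →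
      g x₀ * ρ ^ n ≤ C * ∫ x in closedBall x₀ ρ, g x := by
  obtain ⟨C₀, hC₀, hst⟩ := exists_abs_deriv_smoothTransition_le
  have hnt : Nontrivial (Euc n) := by
    have : Nonempty (Fin n) := ⟨⟨0, by omega⟩⟩
    infer_instance
  set W := volume.real (ball (0 : Euc n) 1) with hW
  have hW0 : 0 < W := 
    ENNReal.toReal_pos (measure_ball_pos _ _ one_pos).ne' measure_ball_lt_top.ne
  refine ⟨2 * 2 ^ n / W * (8 * C₀ * Real.exp (4 * m) * 2 ^ n), by positivity, ?_⟩
  intro B g hB hdiv hg x₀ ρ hρ hρ1 hρx hball hBm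
  set c₂ := 8 * C₀ * Real.exp (4 * m) * 2 ^ n / ρ ^ n with hc₂
  have hx₀ : x₀ ∈ ball (0 : Euc n) 1 := hball (mem_closedBall_self hρ.le)
  have hx₀0 : x₀ ≠ 0 := norm_pos_iff.1 (hρ.trans_le hρx)
  have hgx : 0 < g x₀ := hg.1 x₀ hx₀ hx₀0
  have hSo : IsOpen (ball (0 : Euc n) 1 \ {0}) := isOpen_ball.sdiff isClosed_singleton
  have hgc : ContinuousAt g x₀ :=
    (hg.2.1.contDiffAt (hSo.mem_nhds ⟨hx₀, hx₀0⟩)).continuousAt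
  obtain ⟨η, hη, hgη⟩ := Metric.nhds_basis_closedBall.eventually_iff.1
    (hgc.eventually (lt_mem_nhds (half_lt_self hgx)))
  set ε := min η (min (ρ / 2) (1 / m)) with hε
  have hε0 : 0 < ε := by positivity
  have hεη : ε ≤ η := min_le_left _ _
  have hερ : ε ≤ ρ / 2 := (min_le_right _ _).trans (min_le_left _ _)
  have hεm : m * ε ≤ 1 := by
    have : ε ≤ 1 / m := (min_le_right _ _).trans (min_le_right _ _)
    rw [le_div_iff₀ hm] at this
    linarith
  have hε2 : ε ^ 2 ≤ ρ ^ 2 / 4 := by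
    have := pow_le_pow_left₀ hε0.le hερ 2
    linarith [div_pow ρ 2 2]
  have hρ1' : ρ ^ 2 ≤ 1 := pow_le_one₀ hρ.le hρ1
  set p : ℝ → ℝ := fun u => poleProfile n m ε u * Real.smoothTransition (2 - 2 / ρ ^ 2 * u) with hp
  have hρ2 : 0 < ρ ^ 2 := by positivity
  have hP0 : ∀ u, 0 ≤ poleProfile n m ε u := fun u => by unfold poleProfile; positivity
  have hp_out : ∀ u, ρ ^ 2 ≤ u → p u = 0 := fun u hu => by
    have : 2 - 2 / ρ ^ 2 * u ≤ 0 := by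
      have : 2 ≤ 2 / ρ ^ 2 * u := by
        rw [div_mul_eq_mul_div, le_div_iff₀ hρ2]; linarith
      linarith
    simp [hp, Real.smoothTransition.zero_of_nonpos this]
  have hp_deriv : ∀ u, 0 ≤ u → deriv p u =
      poleProfile n m ε u * (m / √(ε ^ 2 + u) - n / (2 * (ε ^ 2 + u))) *
        Real.smoothTransition (2 - 2 / ρ ^ 2 * u) +
      poleProfile n m ε u * (deriv Real.smoothTransition (2 - 2 / ρ ^ 2 * u) * -(2 / ρ ^ 2)) := by
    intro u hu
    have h1 : HasDerivAt (fun v => 2 - 2 / ρ ^ 2 * v) (-(2 / ρ ^ 2)) u := by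
      simpa using ((hasDerivAt_id u).const_mul (2 / ρ ^ 2)).const_sub 2
    have h2 := ((Real.smoothTransition.contDiff (n := 1)).differentiable one_ne_zero
      (2 - 2 / ρ ^ 2 * u)).hasDerivAt.comp u h1
    exact ((hasDerivAt_poleProfile (by positivity)).mul h2).deriv
  have hp_smooth : ContDiffOn ℝ (⊤ : ℕ∞) p (Ioi (-ε ^ 2)) :=
    contDiffOn_poleProfile.mul (Real.smoothTransition.contDiff.comp
      (contDiff_const.sub (contDiff_const.mul contDiff_id))).contDiffOn
  have hεa : -ε ^ 2 < 0 := by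
    have : 0 < ε ^ 2 := by positivity
    linarith
  have key := mul_setIntegral_le_of_le_radialOp hn hB hdiv hg x₀ hεa hp_smooth
    (fun u _ => mul_nonneg (hP0 u) (Real.smoothTransition.nonneg _)) hρ hp_out hball
    (S₁ := closedBall x₀ ε) (S₂ := closedBall x₀ ρ) measurableSet_closedBall
    measurableSet_closedBall
    ((closedBall_subset_closedBall (hερ.trans (by linarith))).trans hball) hball
    (c₁ := 1 / (2 * ε) ^ n) (c₂ := c₂) ?_
  · have hzero : ∫ t in ‖x₀‖ ^ 2..ρ ^ 2, p t = 0 := by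
      have h1 : ρ ^ 2 ≤ ‖x₀‖ ^ 2 := pow_le_pow_left₀ hρ.le hρx 2
      refine (intervalIntegral.integral_congr (g := fun _ => (0 : ℝ)) fun t ht => ?_).trans
        (by simp)
      rw [uIcc_of_ge h1] at ht
      exact hp_out t ht.1
    rw [hzero, zero_add] at key
    have hlow : g x₀ / 2 * (ε ^ n * W) ≤ ∫ x in closedBall x₀ ε, g x := by
      rw [← volume_real_closedBall_zero x₀ hε0.le, mul_comm, ← smul_eq_mul, ← setIntegral_const]
      refine setIntegral_mono_on (integrableOn_const measure_closedBall_lt_top.ne) ?_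
        measurableSet_closedBall fun x hx => ?_
      · exact hg.2.2.1.mono_set
          ((closedBall_subset_closedBall (hερ.trans (by linarith))).trans hball)
      · exact (hgη (closedBall_subset_closedBall hεη hx)).le
    have h2 : 1 / (2 * ε) ^ n * (g x₀ / 2 * (ε ^ n * W)) ≤
        c₂ * ∫ x in closedBall x₀ ρ, g x := (by gcongr : _ ≤ _).trans key
    have h3 : 1 / (2 * ε) ^ n * (g x₀ / 2 * (ε ^ n * W)) = g x₀ * W / (2 * 2 ^ n) := by
      rw [mul_pow]
      field_simp
    rw [h3, hc₂] at h2
    set I := ∫ x in closedBall x₀ ρ, g x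
    rw [div_le_iff₀ (by positivity)] at h2
    have h4 : g x₀ * ρ ^ n = g x₀ * W * (ρ ^ n / W) := by field_simp
    rw [h4]
    calc g x₀ * W * (ρ ^ n / W) ≤ _ := mul_le_mul_of_nonneg_right h2 (by positivity)
      _ = _ := by field_simp
  · intro x hx
    set u := ‖x - x₀‖ ^ 2 with hu
    have hu0 : 0 ≤ u := sq_nonneg _
    have hsq : √u = ‖x - x₀‖ := Real.sqrt_sq (norm_nonneg _)
    by_cases hxρ : x ∈ closedBall x₀ ρ
    · have hxn : ‖x - x₀‖ ≤ ρ := by rwa [mem_closedBall, dist_eq_norm] at hxρ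
      have huρ : u ≤ ρ ^ 2 := pow_le_pow_left₀ (norm_nonneg _) hxn 2
      have ht : |⟪B x, x - x₀⟫| ≤ m * √u := by
        rw [hsq]
        exact (abs_real_inner_le_norm _ _).trans
          (mul_le_mul_of_nonneg_right (hBm x hxρ) (norm_nonneg _))
      obtain ⟨hb0, hb1⟩ := poleProfile_bracket hn hm hε0 hεm hu0 ht
      set Q := 4 * u * (m / √(ε ^ 2 + u) - n / (2 * (ε ^ 2 + u))) + 2 * n + 2 * ⟪B x, x - x₀⟫
      set θ := Real.smoothTransition (2 - 2 / ρ ^ 2 * u) with hθ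
      set θ' := deriv Real.smoothTransition (2 - 2 / ρ ^ 2 * u) with hθ'
      set P := poleProfile n m ε u with hPdef
      have hop : radialOp B x₀ p x = θ * P * Q - 8 * (u / ρ ^ 2) * P * θ' := by
        unfold radialOp
        rw [← hu, hp_deriv u hu0]
        simp only [hp]
        ring
      have herr : 8 * (u / ρ ^ 2) * P * θ' ≤ c₂ := by
        rcases lt_or_ge u (ρ ^ 2 / 2) with h | h
        · have : 1 < 2 - 2 / ρ ^ 2 * u := by
            have : 2 / ρ ^ 2 * u < 1 := by
              rw [div_mul_eq_mul_div, div_lt_one hρ2]; linarith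
            linarith
          rw [hθ', deriv_smoothTransition_eq_zero_of_one_lt this, mul_zero]
          positivity
        · have hw1 : ρ / 2 ≤ √(ε ^ 2 + u) := by
            refine Real.le_sqrt_of_sq_le ?_
            linarith [sq_nonneg ε, div_pow ρ 2 2]
          have hw2 : √(ε ^ 2 + u) ≤ 2 := by
            rw [Real.sqrt_le_iff]
            constructor <;> linarith
          have hw3 : 2 * m * √(ε ^ 2 + u) ≤ 4 * m := by
            linarith [mul_le_mul_of_nonneg_left hw2 hm.le]
          have hPle : P ≤ Real.exp (4 * m) / (ρ / 2) ^ n :=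
            div_le_div₀ (Real.exp_pos _).le (Real.exp_le_exp.2 hw3) (by positivity)
              (pow_le_pow_left₀ (by positivity) hw1 n)
          have hPnn : 0 ≤ P := hP0 u
          have hur : u / ρ ^ 2 ≤ 1 := (div_le_one hρ2).2 huρ
          calc 8 * (u / ρ ^ 2) * P * θ' ≤ 8 * 1 * (Real.exp (4 * m) / (ρ / 2) ^ n) * C₀ := by
                refine mul_le_mul_of_nonneg ?_ ((le_abs_self _).trans (hst _)) ?_ hC₀.le
                · gcongr
                · positivity
            _ = c₂ := by rw [hc₂, div_pow]; field_simp
      have hθ0 : 0 ≤ θ := Real.smoothTransition.nonneg _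
      have hmain : (closedBall x₀ ε).indicator (fun _ => 1 / (2 * ε) ^ n) x ≤ θ * P * Q := by
        by_cases hxε : x ∈ closedBall x₀ ε
        · rw [indicator_of_mem hxε]
          have hxn : ‖x - x₀‖ ≤ ε := by rwa [mem_closedBall, dist_eq_norm] at hxε
          have huε : u ≤ ε ^ 2 := pow_le_pow_left₀ (norm_nonneg _) hxn 2
          have hθ1 : θ = 1 := by
            refine Real.smoothTransition.one_of_one_le ?_
            have : 2 / ρ ^ 2 * u ≤ 1 := by
              rw [div_mul_eq_mul_div, div_le_one hρ2]; linarith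
            linarith
          have hw2 : √(ε ^ 2 + u) ≤ 2 * ε := by
            rw [Real.sqrt_le_iff, mul_pow]
            constructor <;> linarith
          have hwp : 0 < √(ε ^ 2 + u) := Real.sqrt_pos.2 (by positivity)
          have hPge : 1 / (2 * ε) ^ n ≤ P :=
            div_le_div₀ (Real.exp_pos _).le (Real.one_le_exp (by positivity)) (pow_pos hwp n)
              (pow_le_pow_left₀ hwp.le hw2 n)
          rw [hθ1, one_mul]
          exact hPge.trans (le_mul_of_one_le_right (hP0 u) (hb1 huε))
        · rw [indicator_of_notMem hxε]
          exact mul_nonneg (mul_nonneg hθ0 (hP0 u)) hb0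
      rw [indicator_of_mem hxρ, hop]
      linarith
    · have hxn : ρ < ‖x - x₀‖ := by rwa [mem_closedBall, dist_eq_norm, not_le] at hxρ
      have huρ : ρ ^ 2 < u := pow_lt_pow_left₀ hxn hρ.le two_ne_zero
      have hxε : x ∉ closedBall x₀ ε := fun h =>
        hxρ (closedBall_subset_closedBall (hερ.trans (by linarith)) h)
      have hd : deriv p u = 0 := by
        have : p =ᶠ[𝓝 u] fun _ => 0 := by
          filter_upwards [Ioi_mem_nhds huρ] with v hv
          exact hp_out v (le_of_lt hv)
        rw [this.deriv_eq, deriv_const]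
      rw [indicator_of_notMem hxρ, indicator_of_notMem hxε, radialOp, ← hu, hd,
        hp_out u huρ.le]
      simp

/-- Profile of a subsolution for drifts of size at most `M * δ ^ (β - 1)`, used to control the
mass of the Green's function at scale `r` around its pole. -/
def massProfile (β A r u : ℝ) : ℝ :=
  Real.exp (-(A * (1 - u) ^ β)) * (r ^ 2 + u) ^ (-(5 / 4) : ℝ)

theorem hasDerivAt_massProfile {β A r u : ℝ} (hu : 0 < r ^ 2 + u) (hu1 : u < 1) :
    HasDerivAt (massProfile β A r)
      (massProfile β A r u * (A * β * (1 - u) ^ (β - 1) - 5 / 4 / (r ^ 2 + u))) u := by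
  have h1 : HasDerivAt (fun v => 1 - v) (-1) u := by
    simpa using (hasDerivAt_id u).const_sub 1
  have h2 : HasDerivAt (fun v => r ^ 2 + v) 1 u := by
    simpa using (hasDerivAt_id u).const_add (r ^ 2)
  have h3 : 0 < 1 - u := by linarith
  have h4 := ((h1.rpow_const (p := β) (Or.inl h3.ne')).const_mul A).neg.exp.mul
    (h2.rpow_const (p := -(5 / 4)) (Or.inl hu.ne'))
  refine h4.congr_deriv ?_
  simp only [massProfile, Pi.neg_apply]
  rw [Real.rpow_sub_one hu.ne']
  field_simp
  ring

theorem contDiffOn_massProfile {β A r : ℝ} {k : WithTop ℕ∞} :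
    ContDiffOn ℝ k (massProfile β A r) (Ioo (-r ^ 2) 1) := by
  have h1 : ContDiffOn ℝ k (fun u : ℝ => (1 - u) ^ β) (Ioo (-r ^ 2) 1) :=
    (contDiffOn_const.sub contDiffOn_id).rpow_const_of_ne fun u hu => by
      have : u < 1 := hu.2
      simp only [id]
      linarith
  have h2 : ContDiffOn ℝ k (fun u : ℝ => (r ^ 2 + u) ^ (-(5 / 4) : ℝ)) (Ioo (-r ^ 2) 1) :=
    (contDiffOn_const.add contDiffOn_id).rpow_const_of_ne fun u hu => by
      have : -r ^ 2 < u := hu.1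
      simp only [id]
      linarith
  exact ((contDiffOn_const.mul h1).neg.exp).mul h2

theorem half_le_massProfile_bracket {n : ℕ} (hn : 3 ≤ n) {β M r u t : ℝ} (hβ0 : 0 < β)
    (hβ1 : β < 1) (hM : 0 < M) (hr : 0 < r) (hu : 0 ≤ u) (hu1 : u < 1)
    (ht : |t| ≤ M * (1 - √u) ^ (β - 1) * √u) :
    1 / 2 ≤ 4 * u * ((4 * M ^ 2 + 2 * M) * (1 - u) ^ (β - 1) - 5 / 4 / (r ^ 2 + u)) +
      2 * n + 2 * t := by
  have hn' : (3 : ℝ) ≤ n := by exact_mod_cast hn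
  have hs0 : 0 ≤ √u := Real.sqrt_nonneg u
  have hs2 : √u ^ 2 = u := Real.sq_sqrt hu
  have hs1 : √u < 1 := by rw [Real.sqrt_lt' one_pos]; simpa using hu1
  have h0 : 4 * u * (5 / 4 / (r ^ 2 + u)) ≤ 5 := by
    have hru : 0 < r ^ 2 + u := by positivity
    rw [div_div, ← mul_div_assoc, div_le_iff₀ (by positivity)]
    nlinarith [sq_nonneg r]
  have hpow : ∀ y : ℝ, 0 < y → (y / 2) ^ (β - 1) ≤ 2 * y ^ (β - 1) := fun y hy => by
    rw [Real.div_rpow hy.le zero_le_two, div_eq_mul_inv, ← Real.rpow_neg zero_le_two, mul_comm]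
    gcongr
    calc (2 : ℝ) ^ (-(β - 1)) ≤ 2 ^ (1 : ℝ) :=
          Real.rpow_le_rpow_of_exponent_le one_le_two (by linarith)
      _ = 2 := Real.rpow_one 2
  set D := (1 - u) ^ (β - 1) with hD
  have hD0 : 0 < D := Real.rpow_pos_of_pos (by linarith) _
  have h1 : (1 - √u) ^ (β - 1) ≤ 2 * D :=
    (Real.rpow_le_rpow_of_nonpos (by linarith) (by nlinarith : (1 - u) / 2 ≤ 1 - √u)
      (by linarith)).trans (hpow (1 - u) (by linarith))
  have h2 : |t| ≤ 2 * M * √u * D := by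
    refine ht.trans ?_
    have := mul_le_mul_of_nonneg_left h1 (mul_nonneg hM.le hs0)
    linarith
  have h3 : 4 * M * √u * D ≤ 1 / 2 + 4 * u * ((4 * M ^ 2 + 2 * M) * D) := by
    rcases le_total u (1 / 2) with h | h
    · have hD2 : D ≤ 2 := by
        have h4 := hpow 1 one_pos
        rw [Real.one_rpow, mul_one] at h4
        exact (Real.rpow_le_rpow_of_nonpos (by norm_num) (by linarith : 1 / 2 ≤ 1 - u)
          (by linarith)).trans h4
      have h5 : 4 * M * √u ≤ 1 / 4 + 16 * M ^ 2 * u := by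
        nlinarith [sq_nonneg (4 * M * √u - 1 / 2)]
      have h6 := mul_le_mul_of_nonneg_right h5 hD0.le
      have h7 : 0 ≤ u * M * D := by positivity
      linarith
    · have h4 : √u ≤ 2 * u := by nlinarith
      have h5 := mul_le_mul_of_nonneg_left h4 (mul_nonneg hM.le hD0.le)
      have h7 : 0 ≤ u * M ^ 2 * D := by positivity
      linarith
  have h4 := neg_le_of_abs_le h2
  rw [mul_sub]
  linarith

set_option maxHeartbeats 1000000 in
/-- The mass of the Green's function in a ball of radius `r` around its pole is `O(r ^ 2)`. -/
theorem exists_setIntegral_green_le (n : ℕ) (hn : 3 ≤ n) {β M : ℝ} (hβ0 : 0 < β) (hβ1 : β < 1)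
    (hM : 0 < M) :
    ∃ C > 0, ∀ (B : Euc n → Euc n) (g : Euc n → ℝ), AdmissibleDrift β M B → IsGreenPole B 0 g →
      ∀ r, 0 < r → r ≤ 3 / 4 → ∫ x in closedBall 0 r, g x ≤ C * r ^ 2 := by
  obtain ⟨C₀, hC₀, hst⟩ := exists_abs_deriv_smoothTransition_le
  have hnt : Nontrivial (Euc n) := by
    have : Nonempty (Fin n) := ⟨⟨0, by omega⟩⟩
    infer_instance
  set W := volume.real (ball (0 : Euc n) 1) with hW
  have hW0 : 0 < W :=
    ENNReal.toReal_pos (measure_ball_pos _ _ one_pos).ne' measure_ball_lt_top.ne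
  set A := (4 * M ^ 2 + 2 * M) / β with hA
  have hA0 : 0 < A := by positivity
  have hAβ : A * β = 4 * M ^ 2 + 2 * M := by rw [hA]; field_simp
  refine ⟨(4 + 8 * n * W * C₀) * (2 * Real.exp A * 2 ^ (5 / 4 : ℝ)), by positivity, ?_⟩
  rintro B g ⟨hB, hBM, hdiv⟩ hg r hr hr34
  have hr2 : 0 < r ^ 2 := by positivity
  have hr2' : r ^ 2 ≤ 9 / 16 := by nlinarith
  obtain ⟨t, ht1, htg⟩ := hg.2.2.2.2.1 (r ^ 2) hr2
  set κ := min (7 / 32) ((1 - t) / 4) with hκ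
  have hκ0 : 0 < κ := lt_min (by norm_num) (by linarith)
  have hκ1 : κ ≤ 7 / 32 := min_le_left _ _
  have hκ2 : κ ≤ (1 - t) / 4 := min_le_right _ _
  set R := √(1 - κ) with hR
  have hRsq : R ^ 2 = 1 - κ := Real.sq_sqrt (by linarith)
  have hR0 : 0 < R := Real.sqrt_pos.2 (by linarith)
  have hR1 : R < 1 := by rw [hR, Real.sqrt_lt' one_pos]; linarith
  set p : ℝ → ℝ := fun u => massProfile β A r u * Real.smoothTransition ((1 - u) / κ - 1) with hp
  have hP0 : ∀ u, 0 ≤ u → 0 ≤ massProfile β A r u := fun u hu => by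
    unfold massProfile; positivity
  have hPle : ∀ u, 0 ≤ u → u ≤ 1 → massProfile β A r u ≤ (r ^ 2 + u) ^ (-(5 / 4) : ℝ) :=
    fun u hu hu1 => by
      refine mul_le_of_le_one_left (by positivity) (Real.exp_le_one_iff.2 ?_)
      exact neg_nonpos.2 (mul_nonneg hA0.le (Real.rpow_nonneg (by linarith) _))
  have hp_out : ∀ u, R ^ 2 ≤ u → p u = 0 := fun u hu => by
    have : (1 - u) / κ - 1 ≤ 0 := by
      rw [sub_nonpos, div_le_one hκ0]; linarith
    simp [hp, Real.smoothTransition.zero_of_nonpos this]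
  have hp_deriv : ∀ u, 0 ≤ u → u < 1 → deriv p u =
      massProfile β A r u * (A * β * (1 - u) ^ (β - 1) - 5 / 4 / (r ^ 2 + u)) *
        Real.smoothTransition ((1 - u) / κ - 1) +
      massProfile β A r u * (deriv Real.smoothTransition ((1 - u) / κ - 1) * (-1 / κ)) := by
    intro u hu hu1
    have h1 : HasDerivAt (fun v => (1 - v) / κ - 1) (-1 / κ) u := by
      simpa using (((hasDerivAt_id u).const_sub 1).div_const κ).sub_const 1
    have h2 := ((Real.smoothTransition.contDiff (n := 1)).differentiable one_ne_zero
      ((1 - u) / κ - 1)).hasDerivAt.comp u h1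
    exact ((hasDerivAt_massProfile (by positivity) hu1).mul h2).deriv
  have hp_smooth : ContDiffOn ℝ (⊤ : ℕ∞) p (Ioi (-r ^ 2)) := by
    intro u hu
    refine ContDiffAt.contDiffWithinAt ?_
    rcases lt_or_ge u 1 with h | h
    · refine (contDiffOn_massProfile.contDiffAt (Ioo_mem_nhds hu h)).mul ?_
      exact (Real.smoothTransition.contDiff.comp
        (((contDiff_const.sub contDiff_id).div_const κ).sub contDiff_const)).contDiffAt
    · refine (contDiffAt_const (c := (0 : ℝ))).congr_of_eventuallyEq ?_
      filter_upwards [Ioi_mem_nhds (show R ^ 2 < u by linarith)] with v hv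
      exact hp_out v (le_of_lt hv)
  set c₁ := 1 / 2 * (Real.exp (-A) * (2 * r ^ 2) ^ (-(5 / 4) : ℝ)) with hc₁
  set c₂ := 4 * (r ^ 2) ^ (-(5 / 4) : ℝ) * C₀ / κ with hc₂
  have hS₁ : closedBall (0 : Euc n) r ⊆ ball 0 1 := closedBall_subset_ball (by linarith)
  set S₂ := ball (0 : Euc n) 1 \ closedBall 0 (1 - 2 * κ) with hS₂
  have hS₂m : MeasurableSet S₂ := measurableSet_ball.diff measurableSet_closedBall
  have key := mul_setIntegral_le_of_le_radialOp hn hB (fun x hx => (hdiv x hx).2) hg 0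
    (show -r ^ 2 < 0 by linarith) hp_smooth
    (fun u hu => mul_nonneg (hP0 u hu) (Real.smoothTransition.nonneg _)) hR0 hp_out
    (closedBall_subset_ball hR1) (S₁ := closedBall 0 r) (S₂ := S₂) measurableSet_closedBall
    hS₂m hS₁ sdiff_subset (c₁ := c₁) (c₂ := c₂) ?_
  · have hint : ∫ t in ‖(0 : Euc n)‖ ^ 2..R ^ 2, p t ≤ 4 * (r ^ 2) ^ (-(1 / 4) : ℝ) := by
      rw [norm_zero, zero_pow two_ne_zero]
      have hc : ContinuousOn (fun t : ℝ => (r ^ 2 + t) ^ (-(5 / 4) : ℝ)) (uIcc 0 (R ^ 2)) := by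
        rw [uIcc_of_le (sq_nonneg R)]
        exact (continuousOn_const.add continuousOn_id).rpow_const fun t ht =>
          Or.inl (add_pos_of_pos_of_nonneg hr2 ht.1).ne'
      have hpc : ContinuousOn p (uIcc 0 (R ^ 2)) := by
        rw [uIcc_of_le (sq_nonneg R)]
        exact hp_smooth.continuousOn.mono fun t ht => by
          have := ht.1
          rw [mem_Ioi]; linarith
      calc ∫ t in (0 : ℝ)..R ^ 2, p t ≤ ∫ t in (0 : ℝ)..R ^ 2, (r ^ 2 + t) ^ (-(5 / 4) : ℝ) := by
            refine intervalIntegral.integral_mono_on (sq_nonneg R) hpc.intervalIntegrable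
              hc.intervalIntegrable fun t ht => ?_
            exact (mul_le_of_le_one_right (hP0 t ht.1) (Real.smoothTransition.le_one _)).trans
              (hPle t ht.1 (by linarith [ht.2]))
        _ = 4 * (r ^ 2) ^ (-(1 / 4) : ℝ) - 4 * (r ^ 2 + R ^ 2) ^ (-(1 / 4) : ℝ) := by
            rw [intervalIntegral.integral_comp_add_left (fun s : ℝ => s ^ (-(5 / 4) : ℝ)),
              integral_rpow (Or.inr ⟨by norm_num, ?_⟩)]
            · norm_num
              ring
            · rw [uIcc_of_le (by nlinarith)]
              intro h
              linarith [h.1]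
        _ ≤ _ := by
            have : 0 ≤ (r ^ 2 + R ^ 2) ^ (-(1 / 4) : ℝ) := by positivity
            linarith
    have hvol : volume.real S₂ ≤ 2 * n * κ * W := by
      have h1 : volume.real S₂ = W - (1 - 2 * κ) ^ n * W := by
        rw [hS₂, measureReal_sdiff (closedBall_subset_ball (by linarith)) measurableSet_closedBall,
          volume_real_closedBall_zero _ (by linarith)]
      have h2 := one_add_mul_le_pow (show (-2 : ℝ) ≤ -(2 * κ) by linarith) n
      have h3 : 1 + n * -(2 * κ) ≤ (1 - 2 * κ) ^ n := by simpa [sub_eq_add_neg] using h2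
      rw [h1]
      have h4 := mul_le_mul_of_nonneg_right h3 hW0.le
      linarith
    have hann : ∫ x in S₂, g x ≤ r ^ 2 * (2 * n * κ * W) := by
      calc ∫ x in S₂, g x ≤ ∫ x in S₂, r ^ 2 := by
            refine setIntegral_mono_on (hg.2.2.1.mono_set sdiff_subset)
              (integrableOn_const ((measure_mono sdiff_subset).trans_lt measure_ball_lt_top).ne) hS₂m fun x hx => ?_
            have hx2 : 1 - 2 * κ < ‖x‖ := by
              have := hx.2
              rwa [mem_closedBall_zero_iff, not_le] at this
            exact (le_abs_self _).trans (htg x hx.1 (by linarith)).le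
        _ = r ^ 2 * volume.real S₂ := by rw [setIntegral_const, smul_eq_mul, mul_comm]
        _ ≤ _ := by gcongr
    have hr54 : r ^ 2 * (r ^ 2) ^ (-(5 / 4) : ℝ) = (r ^ 2) ^ (-(1 / 4) : ℝ) := by
      conv_lhs => rw [← Real.rpow_one (r ^ 2), ← Real.rpow_mul hr2.le, one_mul, ← Real.rpow_add hr2]
      norm_num
    set q := (r ^ 2) ^ (-(5 / 4) : ℝ) with hq
    have hq0 : 0 < q := by positivity
    have hc₁' : c₁ = q / (2 * Real.exp A * 2 ^ (5 / 4 : ℝ)) := by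
      rw [hc₁, Real.mul_rpow zero_le_two hr2.le, ← hq, Real.exp_neg,
        Real.rpow_neg zero_le_two]
      field_simp
    have h5 : c₂ * ∫ x in S₂, g x ≤ 8 * n * W * C₀ * (r ^ 2 * q) := by
      calc c₂ * ∫ x in S₂, g x ≤ c₂ * (r ^ 2 * (2 * n * κ * W)) := by gcongr
        _ = _ := by rw [hc₂]; field_simp; ring
    have h6 : c₁ * ∫ x in closedBall 0 r, g x ≤ (4 + 8 * n * W * C₀) * (r ^ 2 * q) := by
      rw [← hr54] at hint
      linarith
    rw [hc₁', div_mul_eq_mul_div, div_le_iff₀ (by positivity)] at h6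
    refine le_of_mul_le_mul_left (h6.trans_eq ?_) hq0
    ring
  · intro x hx
    have hx1 : ‖x‖ < 1 := mem_ball_zero_iff.1 hx
    set u := ‖x‖ ^ 2 with hu
    have hu0 : 0 ≤ u := sq_nonneg _
    have hu1 : u < 1 := pow_lt_one₀ (norm_nonneg _) hx1 two_ne_zero
    have hsq : √u = ‖x‖ := Real.sqrt_sq (norm_nonneg _)
    have ht : |⟪B x, x⟫| ≤ M * (1 - √u) ^ (β - 1) * √u := by
      rw [hsq]
      refine (abs_real_inner_le_norm _ _).trans
        (mul_le_mul_of_nonneg_right ?_ (norm_nonneg _))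
      have hδ : 0 < 1 - ‖x‖ := by linarith
      rw [show β - 1 = -(1 - β) by ring, Real.rpow_neg hδ.le, ← div_eq_mul_inv,
        le_div_iff₀ (by positivity), mul_comm]
      exact hBM x hx
    have hb := half_le_massProfile_bracket hn hβ0 hβ1 hM hr hu0 hu1 ht
    rw [← hAβ] at hb
    set Q := 4 * u * (A * β * (1 - u) ^ (β - 1) - 5 / 4 / (r ^ 2 + u)) + 2 * n + 2 * ⟪B x, x⟫
    set θ := Real.smoothTransition ((1 - u) / κ - 1) with hθ
    set θ' := deriv Real.smoothTransition ((1 - u) / κ - 1) with hθ'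
    set P := massProfile β A r u with hPdef
    have hPnn : 0 ≤ P := hP0 u hu0
    have hθ0 : 0 ≤ θ := Real.smoothTransition.nonneg _
    have hop : radialOp B 0 p x = θ * P * Q - 4 * u * P * θ' / κ := by
      unfold radialOp
      rw [sub_zero, ← hu, hp_deriv u hu0 hu1]
      simp only [hp]
      ring
    have herr : 4 * u * P * θ' / κ ≤ S₂.indicator (fun _ => c₂) x := by
      rcases lt_or_ge u (1 - 2 * κ) with h | h
      · have : 1 < (1 - u) / κ - 1 := by
          rw [lt_sub_iff_add_lt, lt_div_iff₀ hκ0]; linarith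
        rw [hθ', deriv_smoothTransition_eq_zero_of_one_lt this, mul_zero, zero_div]
        exact indicator_nonneg (fun _ _ => by positivity) x
      · have hxS : x ∈ S₂ := by
          refine ⟨hx, fun h' => ?_⟩
          rw [mem_closedBall_zero_iff] at h'
          nlinarith [norm_nonneg x]
        rw [indicator_of_mem hxS, hc₂]
        have hPq : P ≤ (r ^ 2) ^ (-(5 / 4) : ℝ) :=
          (hPle u hu0 hu1.le).trans
            (Real.rpow_le_rpow_of_nonpos hr2 (by linarith) (by norm_num))
        refine div_le_div_of_nonneg_right ?_ hκ0.le
        calc 4 * u * P * θ' ≤ 4 * 1 * (r ^ 2) ^ (-(5 / 4) : ℝ) * C₀ := by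
              refine mul_le_mul_of_nonneg ?_ ((le_abs_self _).trans (hst _)) ?_ hC₀.le
              · gcongr
              · positivity
          _ = _ := by ring
    have hmain : (closedBall (0 : Euc n) r).indicator (fun _ => c₁) x ≤ θ * P * Q := by
      by_cases hxr : x ∈ closedBall (0 : Euc n) r
      · rw [indicator_of_mem hxr]
        have hur : u ≤ r ^ 2 :=
          pow_le_pow_left₀ (norm_nonneg _) (mem_closedBall_zero_iff.1 hxr) 2
        have hθ1 : θ = 1 := by
          refine Real.smoothTransition.one_of_one_le ?_
          rw [le_sub_iff_add_le, le_div_iff₀ hκ0]; linarith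
        have hPge : Real.exp (-A) * (2 * r ^ 2) ^ (-(5 / 4) : ℝ) ≤ P := by
          refine mul_le_mul (Real.exp_le_exp.2 (neg_le_neg ?_))
            (Real.rpow_le_rpow_of_nonpos (by positivity) (by linarith) (by norm_num))
            (by positivity) (Real.exp_pos _).le
          exact mul_le_of_le_one_right hA0.le
            (Real.rpow_le_one (by linarith) (by linarith) hβ0.le)
        rw [hθ1, one_mul, hc₁, mul_comm]
        exact mul_le_mul hPge hb (by norm_num) hPnn
      · rw [indicator_of_notMem hxr]
        exact mul_nonneg (mul_nonneg hθ0 hPnn) (by linarith)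
    rw [hop]
    linarith

/-- pointwise upper bound `g(x) ≤ K' |x|^{2-n}` for `0 < |x| ≤ 1/2`, for the
Green's function with pole at `0` of `L = -Δ + B·∇` with an admissible drift `B`; the
constant `K'` depends only on `n`, `M`, `β`. -/
theorem green_pole_zero_upper_bound
    (n : ℕ) (hn : 3 ≤ n) (β M : ℝ) (hβ0 : 0 < β) (hβ1 : β < 1) (hM : 0 < M) :
    ∃ K' > (0 : ℝ), ∀ (B : Euc n → Euc n) (g : Euc n → ℝ),
      AdmissibleDrift β M B → IsGreenPole B (0 : Euc n) g →
      ∀ x ∈ ball (0 : Euc n) 1, x ≠ 0 → ‖x‖ ≤ 1 / 2 →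
        g x ≤ K' * ‖x‖ ^ ((2 : ℝ) - n) := by
  have hnt : Nontrivial (Euc n) := by
    have : Nonempty (Fin n) := ⟨⟨0, by omega⟩⟩
    infer_instance
  obtain ⟨C₁, hC₁, h₁⟩ := exists_green_mul_pow_le_setIntegral n hn (m := 4 * M) (by positivity)
  obtain ⟨C₂, hC₂, h₂⟩ := exists_setIntegral_green_le n hn hβ0 hβ1 hM
  refine ⟨C₁ * C₂ * (9 / 4) * 2 ^ n, by positivity, ?_⟩
  intro B g hB hg x _ hx0 hx
  have hxp : 0 < ‖x‖ := norm_pos_iff.2 hx0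
  have hsub : closedBall x (‖x‖ / 2) ⊆ closedBall 0 (3 / 2 * ‖x‖) :=
    closedBall_subset_closedBall' (by rw [dist_zero_right]; linarith)
  have hsub' : closedBall (0 : Euc n) (3 / 2 * ‖x‖) ⊆ ball 0 1 :=
    closedBall_subset_ball (by linarith)
  have hBm : ∀ y ∈ closedBall x (‖x‖ / 2), ‖B y‖ ≤ 4 * M := fun y hy => by
    have hy1 : ‖y‖ ≤ 3 / 4 := by
      have := mem_closedBall_zero_iff.1 (hsub hy)
      linarith
    have h3 : (1 / 4 : ℝ) ≤ (1 - ‖y‖) ^ (1 - β) := by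
      calc (1 / 4 : ℝ) = (1 / 4) ^ (1 : ℝ) := (Real.rpow_one _).symm
        _ ≤ (1 / 4) ^ (1 - β) :=
          Real.rpow_le_rpow_of_exponent_ge (by norm_num) (by norm_num) (by linarith)
        _ ≤ _ := Real.rpow_le_rpow (by norm_num) (by linarith) (by linarith)
    have h4 := hB.2.1 y (hsub' (hsub hy))
    linarith [mul_le_mul_of_nonneg_right h3 (norm_nonneg (B y))]
  have h3 := h₁ B g hB.1 (fun y hy => (hB.2.2 y hy).2) hg x (‖x‖ / 2) (by positivity)
    (by linarith) (by linarith) (hsub.trans hsub') hBm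
  have h4 := h₂ B g hB hg (3 / 2 * ‖x‖) (by positivity) (by linarith)
  have h5 : ∫ y in closedBall x (‖x‖ / 2), g y ≤ ∫ y in closedBall 0 (3 / 2 * ‖x‖), g y := by
    refine setIntegral_mono_set (hg.2.2.1.mono_set hsub') ?_ hsub.eventuallyLE
    filter_upwards [ae_restrict_mem measurableSet_closedBall,
      ae_restrict_of_ae (compl_mem_ae_iff.2 (measure_singleton (0 : Euc n)))] with y hy hy0
    exact (hg.1 y (hsub' hy) hy0).le
  have h6 : g x * (‖x‖ / 2) ^ n ≤ C₁ * (C₂ * (3 / 2 * ‖x‖) ^ 2) :=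
    h3.trans (mul_le_mul_of_nonneg_left (h5.trans h4) hC₁.le)
  rw [div_pow, ← mul_div_assoc, div_le_iff₀ (by positivity), ← le_div_iff₀ (by positivity)] at h6
  refine h6.trans_eq ?_
  rw [Real.rpow_sub hxp, Real.rpow_natCast, Real.rpow_two]
  field_simp
  ring
end
end

section
/- Let Ω = B(0,1) ⊂ ℝⁿ, n ≥ 3, let B be an admissible drift, and suppose that for every y ∈ Ω there is a Green's function g_y of L = −Δ + B·∇ on Ω with pole at y. Then for every 0 < r < 1 there exists a constant K' > 0, depending only on n, M, β and r, such that for every y ∈ Ω with |y| ≤ r and every x ∈ Ω with 0 < |x − y| ≤ δ(y)/2 one has g_y(x) ≤ K' · |x − y|^{2−n}. -/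
open Set Metric MeasureTheory Filter
open scoped RealInnerProductSpace Topology

noncomputable section

/-- The partial derivative `∂ᵢ f`. -/
def pd {n : ℕ} (i : Fin n) (f : Euc n → ℝ) (z : Euc n) : ℝ :=
  fderiv ℝ f z (EuclideanSpace.single i 1)

/-- The Laplacian `∑ᵢ ∂ᵢ∂ᵢ f`. -/
def lap {n : ℕ} (f : Euc n → ℝ) (z : Euc n) : ℝ := ∑ i, pd i (pd i f) z

lemma inner_gradient_eq_sum {n : ℕ} (f : Euc n → ℝ) (v z : Euc n) :
    ⟪v, gradient f z⟫ = ∑ i, v i * pd i f z := by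
  rw [real_inner_comm]
  have h : ⟪gradient f z, v⟫ = fderiv ℝ f z v := by
    simp [gradient]
  rw [h]
  have hv : v = ∑ i, v i • EuclideanSpace.single i (1 : ℝ) := by
    ext j
    simp [Finset.sum_apply, Pi.single_apply]
  conv_lhs => rw [hv]
  simp [pd]

lemma gradient_apply {n : ℕ} (f : Euc n → ℝ) (z : Euc n) (i : Fin n) :
    gradient f z i = pd i f z := by
  have h : ⟪gradient f z, EuclideanSpace.single i (1 : ℝ)⟫ = fderiv ℝ f z (EuclideanSpace.single i 1) := by
    simp [gradient]
  rw [pd, ← h, EuclideanSpace.inner_single_right]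
  simp

lemma measurable_pd {n : ℕ} (i : Fin n) (f : Euc n → ℝ) : Measurable (pd i f) :=
  measurable_fderiv_apply_const ℝ f _

/-- A function that is `C¹` off a single point of `ℝⁿ`, `n ≥ 2`, and integrable together with its
partial derivative `∂ᵢ f`, satisfies `∫ ∂ᵢ f = 0`. -/
theorem integral_pd_eq_zero {n : ℕ} (hn : 2 ≤ n) (i : Fin n) {f : Euc n → ℝ} {y : Euc n}
    (hf : Integrable f) (hd : Integrable (pd i f)) (hc : ContDiffOn ℝ 1 f {y}ᶜ) :
    ∫ z, pd i f z = 0 := by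
  set v : Euc n := EuclideanSpace.single i 1 with hv
  have hopen : IsOpen ({y}ᶜ : Set (Euc n)) := isOpen_compl_singleton
  have hline : ∀ᵐ x : Euc n, ∀ s : ℝ, x + s • v ≠ y := by
    have h0 : volume ((AffineSubspace.mk' y (Submodule.span ℝ {v}) : AffineSubspace ℝ (Euc n)) :
        Set (Euc n)) = 0 := by
      apply Measure.addHaar_affineSubspace
      intro h
      have h1 : (Submodule.span ℝ {v} : Submodule ℝ (Euc n)) = ⊤ := by
        have := congrArg AffineSubspace.direction h
        simpa using this
      have h2 : Module.finrank ℝ (Submodule.span ℝ {v}) = 1 :=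
        finrank_span_singleton (by simp [hv])
      rw [h1, finrank_top, finrank_euclideanSpace_fin] at h2
      omega
    refine measure_mono_null ?_ h0
    intro x hx
    simp only [mem_compl_iff, mem_ofPred_eq, not_forall, not_not, ne_eq] at hx
    obtain ⟨s, hs⟩ := hx
    rw [SetLike.mem_coe, AffineSubspace.mem_mk', vsub_eq_sub, Submodule.mem_span_singleton]
    exact ⟨-s, by rw [← hs]; simp⟩
  have hftc : ∀ᵐ x : Euc n, f (x + v) - f x = ∫ s in Ioc (0 : ℝ) 1, pd i f (x + s • v) := by
    filter_upwards [hline] with x hx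
    rw [← intervalIntegral.integral_of_le zero_le_one]
    have hder : ∀ s : ℝ, HasDerivAt (fun s : ℝ => f (x + s • v)) (pd i f (x + s • v)) s := by
      intro s
      have h1 : HasFDerivAt f (fderiv ℝ f (x + s • v)) (x + s • v) :=
        ((hc.contDiffAt (hopen.mem_nhds (hx s))).differentiableAt (by simp)).hasFDerivAt
      have h2 : HasDerivAt (fun s : ℝ => x + s • v) v s := by
        simpa using ((hasDerivAt_id s).smul_const v).const_add x
      exact h1.comp_hasDerivAt s h2
    have hcont : Continuous (fun s : ℝ => pd i f (x + s • v)) := by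
      have h1 : ContinuousOn (pd i f) {y}ᶜ :=
        (hc.continuousOn_fderiv_of_isOpen hopen le_rfl).clm_apply continuousOn_const
      exact h1.comp_continuous (by fun_prop) hx
    rw [intervalIntegral.integral_eq_sub_of_hasDerivAt (fun s _ => hder s)
      (hcont.intervalIntegrable _ _)]
    simp
  have hshear : MeasurePreserving (fun p : ℝ × Euc n => (p.1, p.2 + p.1 • v))
      ((volume.restrict (Ioc (0 : ℝ) 1)).prod volume)
      ((volume.restrict (Ioc (0 : ℝ) 1)).prod volume) := by
    refine (MeasurePreserving.id _).skew_product (g := fun s x => x + s • v) ?_ ?_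
    · exact Continuous.measurable (by fun_prop)
    · exact Eventually.of_forall fun s => map_add_right_eq_self volume (s • v)
  have hint : Integrable (fun p : ℝ × Euc n => pd i f (p.2 + p.1 • v))
      ((volume.restrict (Ioc (0 : ℝ) 1)).prod volume) :=
    hshear.integrable_comp_of_integrable (g := fun p : ℝ × Euc n => pd i f p.2) (hd.comp_snd _)
  have h1 : ∫ x, (f (x + v) - f x) = 0 := by
    rw [integral_sub (hf.comp_add_right v) hf, integral_add_right_eq_self]
    simp
  rw [integral_congr_ae hftc, ← integral_integral_swap hint] at h1
  simpa [integral_add_right_eq_self (fun x => pd i f x)] using h1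

lemma inner_gradient_gradient {n : ℕ} (f g : Euc n → ℝ) (z : Euc n) :
    ⟪gradient f z, gradient g z⟫ = ∑ i, pd i f z * pd i g z := by
  simp only [inner_gradient_eq_sum, gradient_apply]

lemma abs_pd_le {n : ℕ} (i : Fin n) (f : Euc n → ℝ) (z : Euc n) :
    |pd i f z| ≤ ‖gradient f z‖ := by
  rw [← gradient_apply, ← Real.norm_eq_abs]
  exact PiLp.norm_apply_le _ i

lemma Filter.EventuallyEq.pd_eq {n : ℕ} {i : Fin n} {f g : Euc n → ℝ} {z : Euc n}
    (h : f =ᶠ[𝓝 z] g) : pd i f z = pd i g z := by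
  rw [pd, pd, h.fderiv_eq]

lemma pd_mul {n : ℕ} {i : Fin n} {f g : Euc n → ℝ} {z : Euc n}
    (hf : DifferentiableAt ℝ f z) (hg : DifferentiableAt ℝ g z) :
    pd i (fun w => f w * g w) z = pd i f z * g z + f z * pd i g z := by
  simp only [pd]
  rw [fderiv_fun_mul hf hg]
  simp
  ring

lemma pd_zero_of_eventually {n : ℕ} {i : Fin n} {f : Euc n → ℝ} {z : Euc n}
    (h : ∀ᶠ w in 𝓝 z, f w = 0) : pd i f z = 0 := by
  have h' : f =ᶠ[𝓝 z] fun _ => (0 : ℝ) := h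
  rw [h'.pd_eq]
  simp [pd]

lemma contDiffOn_pd {n : ℕ} (i : Fin n) {f : Euc n → ℝ} {s : Set (Euc n)} {k m : WithTop ℕ∞}
    (hs : IsOpen s) (hf : ContDiffOn ℝ k f s) (hm : m + 1 ≤ k) : ContDiffOn ℝ m (pd i f) s :=
  (hf.fderiv_of_isOpen hs hm).clm_apply contDiffOn_const

lemma eventually_lt_norm {n : ℕ} {t : ℝ} {z : Euc n} (hz : t < ‖z‖) : ∀ᶠ w in 𝓝 z, t < ‖w‖ :=
  continuous_norm.continuousAt.eventually (lt_mem_nhds hz)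

lemma isOpen_ball_diff {n : ℕ} (y : Euc n) : IsOpen (ball (0 : Euc n) 1 \ {y}) :=
  isOpen_ball.sdiff isClosed_singleton

lemma integrable_mul_of_ball {n : ℕ} {u w : Euc n → ℝ} {t : ℝ} (ht : t < 1)
    (hu : IntegrableOn u (ball 0 1)) (hw : ContinuousOn w (ball 0 1))
    (h0 : ∀ z, t < ‖z‖ → u z * w z = 0) : Integrable (fun z => u z * w z) := by
  have hsub : closedBall (0 : Euc n) t ⊆ ball 0 1 := closedBall_subset_ball ht
  have h1 : IntegrableOn (fun z => u z * w z) (closedBall 0 t) :=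
    (hu.mono_set hsub).mul_continuousOn (hw.mono hsub) (isCompact_closedBall _ _)
  refine (integrableOn_iff_integrable_of_support_subset ?_).1 h1
  intro z hz
  by_contra hz'
  rw [mem_closedBall, dist_zero_right, not_le] at hz'
  exact hz (h0 z hz')

lemma ae_ne_point {n : ℕ} (hn : 2 ≤ n) (y : Euc n) : ∀ᵐ z : Euc n, z ≠ y := by
  have : Nonempty (Fin n) := ⟨⟨0, by omega⟩⟩
  rw [ae_iff]
  simp

/-- Integration by parts on the unit ball for a function `G` supported in a smaller ball which is
`C¹` off a single point. -/
theorem integral_pd_mul_eq_neg {n : ℕ} (hn : 2 ≤ n) (i : Fin n) {G W : Euc n → ℝ} {y : Euc n}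
    {t : ℝ} (ht : t < 1) (hG : ContDiffOn ℝ 1 G (ball 0 1 \ {y}))
    (hGi : IntegrableOn G (ball 0 1)) (hGd : IntegrableOn (pd i G) (ball 0 1))
    (hG0 : ∀ z, t < ‖z‖ → G z = 0) (hW : ContDiffOn ℝ 1 W (ball 0 1)) :
    ∫ z, pd i G z * W z = -∫ z, G z * pd i W z := by
  have hG0' : ∀ z, t < ‖z‖ → ∀ᶠ w in 𝓝 z, G w = 0 := fun z hz =>
    (eventually_lt_norm hz).mono hG0
  have hdG0 : ∀ z, t < ‖z‖ → pd i G z = 0 := fun z hz => pd_zero_of_eventually (hG0' z hz)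
  have hI1 : Integrable (fun z => pd i G z * W z) :=
    integrable_mul_of_ball ht hGd hW.continuousOn fun z hz => by rw [hdG0 z hz, zero_mul]
  have hI2 : Integrable (fun z => G z * pd i W z) :=
    integrable_mul_of_ball ht hGi (contDiffOn_pd i isOpen_ball hW (m := 0) (by simp)).continuousOn
      fun z hz => by rw [hG0 z hz, zero_mul]
  have hI0 : Integrable (fun z => G z * W z) :=
    integrable_mul_of_ball ht hGi hW.continuousOn fun z hz => by rw [hG0 z hz, zero_mul]
  have hpd : ∀ z ≠ y, pd i (fun z => G z * W z) z = pd i G z * W z + G z * pd i W z := by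
    intro z hz
    by_cases hzt : t < ‖z‖
    · rw [hdG0 z hzt, hG0 z hzt, pd_zero_of_eventually ((hG0' z hzt).mono fun w hw => by simp [hw])]
      simp
    · have hzb : z ∈ ball (0 : Euc n) 1 := by
        rw [mem_ball, dist_zero_right]; linarith
      exact pd_mul ((hG.contDiffAt ((isOpen_ball_diff y).mem_nhds ⟨hzb, hz⟩)).differentiableAt
        (by simp)) ((hW.contDiffAt (isOpen_ball.mem_nhds hzb)).differentiableAt (by simp))
  have hae : (pd i fun z => G z * W z) =ᵐ[volume] fun z => pd i G z * W z + G z * pd i W z := by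
    filter_upwards [ae_ne_point hn y] with z hz using hpd z hz
  have hcd : ContDiffOn ℝ 1 (fun z => G z * W z) {y}ᶜ := by
    intro z hz
    refine ContDiffAt.contDiffWithinAt ?_
    by_cases hzt : t < ‖z‖
    · exact (contDiffAt_const (c := (0 : ℝ))).congr_of_eventuallyEq
        ((hG0' z hzt).mono fun w hw => by simp [hw])
    · have hzb : z ∈ ball (0 : Euc n) 1 := by
        rw [mem_ball, dist_zero_right]; linarith
      exact (hG.contDiffAt ((isOpen_ball_diff y).mem_nhds ⟨hzb, hz⟩)).mul
        (hW.contDiffAt (isOpen_ball.mem_nhds hzb))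
  have h := integral_pd_eq_zero hn i hI0 ((hI1.add hI2).congr hae.symm) hcd
  rw [integral_congr_ae hae, integral_add hI1 hI2] at h
  linarith

/-- The weak formulation away from the pole holds for `C¹` test functions. -/
theorem IsGreenPole.integral_eq_zero {n : ℕ} (hn : 2 ≤ n) {B : Euc n → Euc n} {y : Euc n}
    {g : Euc n → ℝ} (hB : ContinuousOn B (ball 0 1)) (hg : IsGreenPole B y g) {ζ : Euc n → ℝ}
    (hζ : ContDiff ℝ 1 ζ) (hζc : HasCompactSupport ζ) (hζs : tsupport ζ ⊆ ball 0 1 \ {y}) :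
    ∫ z in ball (0 : Euc n) 1, (⟪gradient g z, gradient ζ z⟫ + ⟪B z, gradient g z⟫ * ζ z) = 0 := by
  obtain ⟨-, hg3, -, -, -, hweak⟩ := hg
  set U := ball (0 : Euc n) 1 \ {y} with hU
  have hUo : IsOpen U := isOpen_ball_diff y
  set P : Euc n → ℝ := fun z => -lap g z + ⟪B z, gradient g z⟫ with hP
  have hp : ∀ i, ContDiffOn ℝ 1 (pd i g) U := fun i =>
    contDiffOn_pd i hUo hg3 (by norm_num)
  have hpp : ∀ i, ContinuousOn (pd i (pd i g)) U := fun i =>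
    (contDiffOn_pd i hUo (hp i) (m := 0) (by simp)).continuousOn
  have hPc : ContinuousOn P U := by
    have h1 : ContinuousOn (fun z => lap g z) U := continuousOn_finsetSum _ fun i _ => hpp i
    have h2 : ContinuousOn (fun z => ⟪B z, gradient g z⟫) U := by
      simp only [inner_gradient_eq_sum]
      refine continuousOn_finsetSum _ fun i _ => ContinuousOn.mul ?_ (hp i).continuousOn
      exact (EuclideanSpace.proj (𝕜 := ℝ) i).continuous.comp_continuousOn (hB.mono sdiff_subset)
    exact h1.neg.add h2
  have hcont : ∀ (u : Euc n → ℝ) (ψ : Euc n → ℝ), ContinuousOn u U → Continuous ψ →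
      tsupport ψ ⊆ U → Continuous (fun z => u z * ψ z) := by
    intro u ψ hu hψ hs
    rw [continuous_iff_continuousAt]
    intro z
    by_cases hz : z ∈ tsupport ψ
    · exact (hu.continuousAt (hUo.mem_nhds (hs hz))).mul hψ.continuousAt
    · have h0 := notMem_tsupport_iff_eventuallyEq.1 hz
      have h1 : (fun z => u z * ψ z) =ᶠ[𝓝 z] fun _ => 0 := by
        filter_upwards [h0] with w hw
        simp [hw]
      exact continuousAt_const.congr h1.symm
  have key : ∀ ψ : Euc n → ℝ, ContDiff ℝ 1 ψ → HasCompactSupport ψ → tsupport ψ ⊆ U →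
      ∫ z in ball (0 : Euc n) 1, (⟪gradient g z, gradient ψ z⟫ + ⟪B z, gradient g z⟫ * ψ z)
        = ∫ z, P z * ψ z := by
    intro ψ hψ hc hs
    have h0 : ∀ z ∉ tsupport ψ, ∀ᶠ w in 𝓝 z, ψ w = 0 := fun z hz =>
      notMem_tsupport_iff_eventuallyEq.1 hz
    have hpd : ∀ i z, pd i (fun w => pd i g w * ψ w) z
        = pd i (pd i g) z * ψ z + pd i g z * pd i ψ z := by
      intro i z
      by_cases hz : z ∈ tsupport ψ
      · exact pd_mul (((hp i).contDiffAt (hUo.mem_nhds (hs hz))).differentiableAt (by simp))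
          (hψ.differentiable (by simp) z)
      · rw [pd_zero_of_eventually ((h0 z hz).mono fun w hw => by simp [hw]),
          pd_zero_of_eventually (h0 z hz), (h0 z hz).self_of_nhds]
        simp
    have hC : ∀ i, ContDiff ℝ 1 (fun w => pd i g w * ψ w) := by
      intro i
      rw [contDiff_iff_contDiffAt]
      intro z
      by_cases hz : z ∈ tsupport ψ
      · exact ((hp i).contDiffAt (hUo.mem_nhds (hs hz))).mul hψ.contDiffAt
      · exact (contDiffAt_const (c := (0 : ℝ))).congr_of_eventuallyEq
          ((h0 z hz).mono fun w hw => by simp [hw])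
    have hCc : ∀ i, HasCompactSupport (fun w => pd i g w * ψ w) := fun i => hc.mul_left
    have hFi : ∀ i, Integrable (fun w => pd i g w * ψ w) := fun i =>
      (hC i).continuous.integrable_of_hasCompactSupport (hCc i)
    have hdFi : ∀ i, Integrable (pd i (fun w => pd i g w * ψ w)) := by
      intro i
      refine Continuous.integrable_of_hasCompactSupport ?_ ?_
      · exact ((hC i).continuous_fderiv (by simp)).clm_apply continuous_const
      · exact (hCc i).fderiv_apply ℝ _
    have hPi : Integrable (fun z => P z * ψ z) :=
      (hcont P ψ hPc hψ.continuous hs).integrable_of_hasCompactSupport hc.mul_left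
    rw [setIntegral_eq_integral_of_forall_compl_eq_zero]
    · have heq : ∀ z, ⟪gradient g z, gradient ψ z⟫ + ⟪B z, gradient g z⟫ * ψ z
          = (∑ i, pd i (fun w => pd i g w * ψ w) z) + P z * ψ z := by
        intro z
        simp only [hpd, hP, lap, inner_gradient_gradient, Finset.sum_add_distrib, ← Finset.sum_mul]
        ring
      simp only [heq]
      rw [integral_add (integrable_finsetSum _ fun i _ => hdFi i) hPi,
        integral_finsetSum _ fun i _ => hdFi i]
      simp only [integral_pd_eq_zero hn _ (hFi _) (hdFi _) ((hC _).contDiffOn (s := {y}ᶜ))]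
      simp
    · intro z hz
      have hz' : z ∉ tsupport ψ := fun h => hz (hs h).1
      rw [inner_gradient_gradient, (h0 z hz').self_of_nhds]
      simp [pd_zero_of_eventually (h0 z hz')]
  have hPae : ∀ᵐ z : Euc n, z ∈ U → P z = 0 := by
    refine hUo.ae_eq_zero_of_integral_contDiff_smul_eq_zero
      (hPc.locallyIntegrableOn hUo.measurableSet) ?_
    intro ψ hψ hc hs
    have h1 := key ψ (hψ.of_le (by simp)) hc hs
    rw [hweak ψ hψ hc (hs.trans sdiff_subset)] at h1
    have h2 : ψ y = 0 := image_eq_zero_of_notMem_tsupport fun h => (hs h).2 rfl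
    rw [h2] at h1
    rw [h1]
    simp only [smul_eq_mul, mul_comm]
  rw [key ζ hζ hζc hζs]
  rw [← integral_zero (Euc n) ℝ (μ := volume)]
  refine integral_congr_ae ?_
  filter_upwards [hPae] with z hz
  by_cases hzs : z ∈ tsupport ζ
  · simp [hz (hζs hzs)]
  · simp [image_eq_zero_of_notMem_tsupport hzs]

lemma contDiff_of_forall_mem_tsupport {n : ℕ} {k : WithTop ℕ∞} {f : Euc n → ℝ}
    (h : ∀ z ∈ tsupport f, ContDiffAt ℝ k f z) : ContDiff ℝ k f := by
  rw [contDiff_iff_contDiffAt]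
  intro z
  by_cases hz : z ∈ tsupport f
  · exact h z hz
  · exact (contDiffAt_const (c := (0 : ℝ))).congr_of_eventuallyEq
      (notMem_tsupport_iff_eventuallyEq.1 hz)

lemma weak_integrand_eq {n : ℕ} (B : Euc n → Euc n) (g ψ : Euc n → ℝ) (z : Euc n) :
    ⟪gradient g z, gradient ψ z⟫ + ⟪B z, gradient g z⟫ * ψ z
      = ∑ i, pd i g z * (pd i ψ z + B z i * ψ z) := by
  rw [inner_gradient_gradient, inner_gradient_eq_sum, Finset.sum_mul, ← Finset.sum_add_distrib]
  exact Finset.sum_congr rfl fun i _ => by ring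

lemma exists_norm_le_of_tsupport {n : ℕ} {ψ : Euc n → ℝ} (hc : HasCompactSupport ψ)
    (hs : tsupport ψ ⊆ ball 0 1) : ∃ t < (1 : ℝ), ∀ z, t < ‖z‖ → z ∉ tsupport ψ := by
  obtain ⟨a, ha, h⟩ := hc.isCompact.exists_forall_le' (f := fun z : Euc n => 1 - ‖z‖) (a := 0)
    (by fun_prop) fun z hz => by simpa using hs hz
  refine ⟨1 - a, by linarith, fun z hz hzs => ?_⟩
  linarith [h z hzs]

lemma integrableOn_pd {n : ℕ} (i : Fin n) {g : Euc n → ℝ} {s : Set (Euc n)}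
    (hg : IntegrableOn (fun x => ‖gradient g x‖) s) : IntegrableOn (pd i g) s :=
  hg.mono' (measurable_pd i g).aestronglyMeasurable
    (Eventually.of_forall fun z => abs_pd_le i g z)

lemma continuousOn_coord {n : ℕ} {B : Euc n → Euc n} {s : Set (Euc n)} (hB : ContinuousOn B s)
    (i : Fin n) : ContinuousOn (fun z => B z i) s :=
  (EuclideanSpace.proj (𝕜 := ℝ) i).continuous.comp_continuousOn hB

lemma integrable_weak_integrand {n : ℕ} {B : Euc n → Euc n} {g ψ : Euc n → ℝ}
    (hB : ContinuousOn B (ball 0 1)) (hg : IntegrableOn (fun x => ‖gradient g x‖) (ball 0 1))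
    (hψ : ContDiff ℝ 1 ψ) (hc : HasCompactSupport ψ) (hs : tsupport ψ ⊆ ball 0 1) :
    Integrable fun z => ⟪gradient g z, gradient ψ z⟫ + ⟪B z, gradient g z⟫ * ψ z := by
  obtain ⟨t, ht, h⟩ := exists_norm_le_of_tsupport hc hs
  simp only [weak_integrand_eq]
  refine integrable_finsetSum _ fun i _ => integrable_mul_of_ball ht (integrableOn_pd i hg) ?_ ?_
  · refine ContinuousOn.add ?_ ((continuousOn_coord hB i).mul hψ.continuous.continuousOn)
    exact ((hψ.continuous_fderiv (by simp)).clm_apply continuous_const).continuousOn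
  · intro z hz
    have h0 := notMem_tsupport_iff_eventuallyEq.1 (h z hz)
    rw [pd_zero_of_eventually h0, h0.self_of_nhds]
    simp

/-- The weak formulation holds for `C¹` test functions that are smooth near the pole. -/
theorem IsGreenPole.integral_eq_apply {n : ℕ} (hn : 2 ≤ n) {B : Euc n → Euc n} {y : Euc n}
    {g : Euc n → ℝ} (hB : ContinuousOn B (ball 0 1)) (hg : IsGreenPole B y g) {ζ : Euc n → ℝ}
    (hζ : ContDiff ℝ 1 ζ) (hζc : HasCompactSupport ζ) (hζs : tsupport ζ ⊆ ball 0 1)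
    {r : ℝ} (hr : 0 < r) (hζr : ContDiffOn ℝ (⊤ : ℕ∞) ζ (ball y r)) :
    ∫ z in ball (0 : Euc n) 1, (⟪gradient g z, gradient ζ z⟫ + ⟪B z, gradient g z⟫ * ζ z)
      = ζ y := by
  let χ : ContDiffBump y := ⟨r / 4, r / 2, by linarith, by linarith⟩
  have hχ : ContDiff ℝ (⊤ : ℕ∞) χ := χ.contDiff
  set ψ : Euc n → ℝ := fun z => χ z * ζ z with hψdef
  set η : Euc n → ℝ := fun z => (1 - χ z) * ζ z with hηdef
  have hψs' : tsupport ψ ⊆ tsupport ζ := tsupport_mul_subset_right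
  have hηs' : tsupport η ⊆ tsupport ζ := tsupport_mul_subset_right
  have hψ : ContDiff ℝ (⊤ : ℕ∞) ψ := by
    refine contDiff_of_forall_mem_tsupport fun z hz => ?_
    have h1 : z ∈ closedBall y (r / 2) := by
      have := tsupport_mul_subset_left (f := χ) (g := ζ) hz
      rwa [χ.tsupport_eq] at this
    exact hχ.contDiffAt.mul
      (hζr.contDiffAt (isOpen_ball.mem_nhds (closedBall_subset_ball (by linarith) h1)))
  have hψ1 : ContDiff ℝ 1 ψ := hψ.of_le (by simp)
  have hη1 : ContDiff ℝ 1 η := (contDiff_const.sub (hχ.of_le (by simp))).mul hζ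
  have hψc : HasCompactSupport ψ := hζc.mul_left
  have hηc : HasCompactSupport η := hζc.mul_left
  have hχy : ∀ᶠ w in 𝓝 y, χ w = 1 := χ.eventuallyEq_one
  have hηs : tsupport η ⊆ ball 0 1 \ {y} := by
    intro z hz
    refine ⟨hζs (hηs' hz), ?_⟩
    rintro rfl
    refine (notMem_tsupport_iff_eventuallyEq.2 ?_) hz
    filter_upwards [hχy] with w hw
    simp [hηdef, hw]
  have h1 := hg.integral_eq_zero hn hB hη1 hηc hηs
  have h2 := hg.2.2.2.2.2 ψ hψ hψc (hψs'.trans hζs)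
  have hi1 := (integrable_weak_integrand hB hg.2.2.2.1 hη1 hηc (hηs'.trans hζs)).integrableOn
    (s := ball 0 1)
  have hi2 := (integrable_weak_integrand hB hg.2.2.2.1 hψ1 hψc (hψs'.trans hζs)).integrableOn
    (s := ball 0 1)
  have hadd : ∀ z i, pd i ζ z = pd i η z + pd i ψ z := by
    intro z i
    have : ζ = fun w => η w + ψ w := by
      ext w; simp only [hηdef, hψdef]; ring
    conv_lhs => rw [this]
    simp only [pd]
    rw [fderiv_fun_add (hη1.differentiable (by simp) z) (hψ1.differentiable (by simp) z)]
    simp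
  have heq : ∀ z, ⟪gradient g z, gradient ζ z⟫ + ⟪B z, gradient g z⟫ * ζ z
      = (⟪gradient g z, gradient η z⟫ + ⟪B z, gradient g z⟫ * η z)
        + (⟪gradient g z, gradient ψ z⟫ + ⟪B z, gradient g z⟫ * ψ z) := by
    intro z
    simp only [weak_integrand_eq, ← Finset.sum_add_distrib]
    refine Finset.sum_congr rfl fun i _ => ?_
    rw [hadd]
    simp only [hηdef, hψdef]
    ring
  simp only [heq]
  rw [integral_add hi1 hi2, h1, h2, hψdef]
  simp [hχy.self_of_nhds]

/-- A smooth convex approximation of `s ↦ (s - κ)⁺`. -/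
lemma exists_smooth_posPart {κ : ℝ} (hκ : 0 < κ) : ∃ (θ H : ℝ → ℝ) (c : ℝ),
    ContDiff ℝ 1 θ ∧ Monotone θ ∧ (∀ s, s ≤ κ → θ s = 0) ∧ (∀ s, 2 * κ ≤ s → θ s = 1) ∧
    (∀ s, HasDerivAt H (θ s) s) ∧ (∀ s, s ≤ κ → H s = 0) ∧ 0 ≤ c ∧ c ≤ 2 * κ ∧
    (∀ s, 2 * κ ≤ s → H s = s - c) ∧ (∀ s, 0 ≤ H s) ∧ (∀ s, |H s| ≤ |s|) := by
  set θ : ℝ → ℝ := fun s => Real.smoothTransition (s / κ - 1) with hθ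
  have hθc : ContDiff ℝ 1 θ := Real.smoothTransition.contDiff.comp (by fun_prop)
  have hcont : Continuous θ := hθc.continuous
  have hmono : Monotone θ := by
    intro a b hab
    exact Real.smoothTransition.monotone (by gcongr)
  have h0 : ∀ s, s ≤ κ → θ s = 0 := fun s hs =>
    Real.smoothTransition.zero_of_nonpos (by rw [sub_nonpos, div_le_one hκ]; exact hs)
  have h1 : ∀ s, 2 * κ ≤ s → θ s = 1 := fun s hs =>
    Real.smoothTransition.one_of_one_le (by rw [le_sub_iff_add_le, le_div_iff₀ hκ]; linarith)
  have hint : ∀ a b, IntervalIntegrable θ volume a b := fun a b => hcont.intervalIntegrable a b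
  have hθ0 : ∀ s, 0 ≤ θ s := fun s => Real.smoothTransition.nonneg _
  have hθ1 : ∀ s, θ s ≤ 1 := fun s => Real.smoothTransition.le_one _
  set H : ℝ → ℝ := fun s => ∫ u in (0 : ℝ)..s, θ u with hH
  have hH0 : ∀ s, s ≤ κ → H s = 0 := by
    intro s hs
    refine intervalIntegral.integral_zero_ae (Eventually.of_forall fun u hu => h0 u ?_)
    rcases le_total 0 s with h | h
    · rw [uIoc_of_le h] at hu; exact hu.2.trans hs
    · rw [uIoc_of_ge h] at hu; exact hu.2.trans hκ.le
  have habs : ∀ s, |H s| ≤ |s| := by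
    intro s
    have := intervalIntegral.norm_integral_le_of_norm_le_const (f := θ) (a := 0) (b := s) (C := 1)
      fun u _ => by rw [Real.norm_of_nonneg (hθ0 u)]; exact hθ1 u
    simpa using this
  have hHn : ∀ s, 0 ≤ H s := by
    intro s
    rcases le_total 0 s with h | h
    · exact intervalIntegral.integral_nonneg h fun u _ => hθ0 u
    · exact (hH0 s (h.trans hκ.le)).ge
  refine ⟨θ, H, 2 * κ - H (2 * κ), hθc, hmono, h0, h1, ?_, hH0, ?_, ?_, ?_, hHn, habs⟩
  · intro s
    exact intervalIntegral.integral_hasDerivAt_right (hint _ _)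
      hcont.aestronglyMeasurable.stronglyMeasurableAtFilter hcont.continuousAt
  · have := habs (2 * κ)
    rw [abs_of_nonneg (hHn _), abs_of_pos (by linarith)] at this
    linarith
  · linarith [hHn (2 * κ)]
  · intro s hs
    have e1 : H s = H (2 * κ) + ∫ u in (2 * κ)..s, θ u :=
      (intervalIntegral.integral_add_adjacent_intervals (hint _ _) (hint _ _)).symm
    have e2 : ∫ u in (2 * κ)..s, θ u = ∫ u in (2 * κ)..s, (1 : ℝ) := by
      refine intervalIntegral.integral_congr fun u hu => h1 u ?_
      rw [uIcc_of_le hs] at hu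
      exact hu.1
    rw [e1, e2]
    simp
    ring

lemma exists_norm_le_of_compact {n : ℕ} {K : Set (Euc n)} (hK : IsCompact K)
    (hs : K ⊆ ball 0 1) : ∃ t < (1 : ℝ), ∀ z ∈ K, ‖z‖ ≤ t := by
  obtain ⟨a, ha, h⟩ := hK.exists_forall_le' (f := fun z : Euc n => 1 - ‖z‖) (a := 0)
    (by fun_prop) fun z hz => by simpa using hs hz
  exact ⟨1 - a, by linarith, fun z hz => by linarith [h z hz]⟩

/-- A compactly supported truncation `G` of a Green's function `g` with `∇G = h ∇g`: `G` differs
from `g` by at most `κ₀`, and `h` is identically `1` near the pole. -/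
theorem IsGreenPole.exists_truncation {n : ℕ} {B : Euc n → Euc n} {y : Euc n}
    {g : Euc n → ℝ} (hg : IsGreenPole B y g) {R : ℝ} (hR : 0 < R)
    (hsub : closedBall y R ⊆ ball 0 1) {κ₀ : ℝ} (hκ₀ : 0 < κ₀) :
    ∃ (h G : Euc n → ℝ) (t r : ℝ), t < 1 ∧ 0 < r ∧
      ContDiffOn ℝ 1 h (ball 0 1) ∧ (∀ z ∈ ball y r, z ∈ ball (0 : Euc n) 1 ∧ h z = 1) ∧
      (∀ z, t < ‖z‖ → h z = 0) ∧
      ContDiffOn ℝ 1 G (ball 0 1 \ {y}) ∧ (∀ z, t < ‖z‖ → G z = 0) ∧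
      (∀ z ∈ ball (0 : Euc n) 1 \ {y}, ∀ i, pd i G z = h z * pd i g z) ∧
      (∀ z ∈ ball (0 : Euc n) 1 \ {y}, ∃ a ≥ 0, ∀ i, pd i h z = a * pd i g z) ∧
      (∀ z ∈ ball (0 : Euc n) 1 \ {y}, |G z| ≤ |g z| + κ₀) ∧
      (∀ z ∈ ball (0 : Euc n) 1 \ {y}, -κ₀ ≤ G z) ∧
      (∀ z ∈ ball (0 : Euc n) 1 \ {y}, z ∉ closedBall y R → 0 ≤ G z) ∧
      (∀ z ∈ ball (0 : Euc n) 1 \ {y}, g z - κ₀ ≤ G z) := by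
  obtain ⟨hpos, hg3, -, -, hlim, -⟩ := hg
  set U := ball (0 : Euc n) 1 \ {y} with hU
  have hUo : IsOpen U := isOpen_ball_diff y
  set A := closedBall y R \ ball y (R / 2) with hA
  have hAU : A ⊆ U := by
    intro z hz
    refine ⟨hsub hz.1, ?_⟩
    rintro rfl
    exact hz.2 (mem_ball_self (by linarith))
  have hAc : IsCompact A := (isCompact_closedBall y R).diff isOpen_ball
  obtain ⟨m, hm, hmA⟩ := hAc.exists_forall_le' (f := g) (a := 0) (hg3.continuousOn.mono hAU)
    fun z hz => hpos z (hAU hz).1 (hAU hz).2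
  set κ := min (m / 2) (κ₀ / 2) with hκdef
  have hκ : 0 < κ := lt_min (by linarith) (by linarith)
  have hκm : 2 * κ ≤ m := by linarith [min_le_left (m / 2) (κ₀ / 2)]
  have hκκ₀ : 2 * κ ≤ κ₀ := by linarith [min_le_right (m / 2) (κ₀ / 2)]
  obtain ⟨θ, H, c, hθ, hθm, hθ0, hθ1, hHd, hH0, hc0, hcκ, hHc, hHn, hHa⟩ :=
    exists_smooth_posPart hκ
  obtain ⟨t₁, ht₁, hgt⟩ := hlim κ hκ
  obtain ⟨t₂, ht₂, hbt⟩ := exists_norm_le_of_compact (isCompact_closedBall y R) hsub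
  have hH1 : ContDiff ℝ 1 H := by
    rw [contDiff_one_iff_deriv]
    refine ⟨fun s => (hHd s).differentiableAt, ?_⟩
    rw [show deriv H = θ from funext fun s => (hHd s).deriv]
    exact hθ.continuous
  classical
  set h : Euc n → ℝ := fun z => if ‖z‖ < 1 then (if ‖z - y‖ < R / 2 then 1 else θ (g z)) else 0
    with hh
  set G : Euc n → ℝ :=
    fun z => if ‖z‖ < 1 then (if ‖z - y‖ < R / 2 then g z - c else H (g z)) else 0 with hGdef
  have hin : ∀ z ∈ ball y R, h z = 1 ∧ G z = g z - c := by
    intro z hz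
    have h1 : ‖z‖ < 1 := by simpa using hsub (ball_subset_closedBall hz)
    by_cases h2 : ‖z - y‖ < R / 2
    · simp [hh, hGdef, h1, h2]
    · have h3 : z ∈ A := ⟨ball_subset_closedBall hz, by rwa [mem_ball, dist_eq_norm]⟩
      have h4 := hκm.trans (hmA z h3)
      simp [hh, hGdef, h1, h2, hθ1 _ h4, hHc _ h4]
  have hout : ∀ z ∈ ball (0 : Euc n) 1, R / 2 < ‖z - y‖ → h z = θ (g z) ∧ G z = H (g z) := by
    intro z hz hzy
    have h1 : ‖z‖ < 1 := by simpa using hz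
    simp [hh, hGdef, h1, not_lt.2 hzy.le]
  have hinE : ∀ z ∈ ball y R, h =ᶠ[𝓝 z] (fun _ => 1) ∧ G =ᶠ[𝓝 z] fun w => g w - c := by
    intro z hz
    exact ⟨by filter_upwards [isOpen_ball.mem_nhds hz] with w hw using (hin w hw).1,
      by filter_upwards [isOpen_ball.mem_nhds hz] with w hw using (hin w hw).2⟩
  have houtE : ∀ z ∈ ball (0 : Euc n) 1, z ∉ ball y R →
      h =ᶠ[𝓝 z] (fun w => θ (g w)) ∧ G =ᶠ[𝓝 z] fun w => H (g w) := by
    intro z hz hzy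
    rw [mem_ball, dist_eq_norm, not_lt] at hzy
    have hc : Continuous fun w : Euc n => ‖w - y‖ := by fun_prop
    have h1 : ∀ᶠ w in 𝓝 z, R / 2 < ‖w - y‖ :=
      hc.continuousAt.eventually_const_lt (by linarith)
    exact ⟨by filter_upwards [isOpen_ball.mem_nhds hz, h1] with w hw hw' using (hout w hw hw').1,
      by filter_upwards [isOpen_ball.mem_nhds hz, h1] with w hw hw' using (hout w hw hw').2⟩
  have hyR : y ∈ ball y R := mem_ball_self hR
  have hgz : ∀ z ∈ U, ContDiffAt ℝ 1 g z := fun z hz =>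
    (hg3.contDiffAt (hUo.mem_nhds hz)).of_le (by norm_num)
  have hbig : ∀ z, max t₁ t₂ < ‖z‖ → h z = 0 ∧ G z = 0 := by
    intro z hz
    by_cases h1 : ‖z‖ < 1
    · have h2 : ¬ ‖z - y‖ < R / 2 := by
        intro h2
        have h3 : z ∈ closedBall y R := by
          rw [mem_closedBall, dist_eq_norm]; linarith
        exact absurd (hbt z h3) (not_le.2 ((le_max_right _ _).trans_lt hz))
      have h3 : g z ≤ κ := (le_abs_self _).trans
        (hgt z (by simpa using h1) ((le_max_left _ _).trans_lt hz)).le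
      simp [hh, hGdef, h1, h2, hθ0 _ h3, hH0 _ h3]
    · simp [hh, hGdef, h1]
  have hcases : ∀ z ∈ U, (G z = g z - c) ∨ (G z = H (g z) ∧ z ∉ ball y R) := by
    intro z hz
    by_cases hzR : z ∈ ball y R
    · exact Or.inl (hin z hzR).2
    · exact Or.inr ⟨(houtE z hz.1 hzR).2.self_of_nhds, hzR⟩
  refine ⟨h, G, max t₁ t₂, R, max_lt ht₁ ht₂, hR, ?_, ?_, fun z hz => (hbig z hz).1, ?_,
    fun z hz => (hbig z hz).2, ?_, ?_, ?_, ?_, ?_, ?_⟩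
  · intro z hz
    refine ContDiffAt.contDiffWithinAt ?_
    by_cases hzR : z ∈ ball y R
    · exact contDiffAt_const.congr_of_eventuallyEq (hinE z hzR).1
    · have hzU : z ∈ U := ⟨hz, by rintro rfl; exact hzR hyR⟩
      exact (hθ.contDiffAt.comp z (hgz z hzU)).congr_of_eventuallyEq (houtE z hz hzR).1
  · exact fun z hz => ⟨hsub (ball_subset_closedBall hz), (hin z hz).1⟩
  · intro z hz
    refine ContDiffAt.contDiffWithinAt ?_
    by_cases hzR : z ∈ ball y R
    · exact ((hgz z hz).sub contDiffAt_const).congr_of_eventuallyEq (hinE z hzR).2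
    · exact (hH1.contDiffAt.comp z (hgz z hz)).congr_of_eventuallyEq (houtE z hz.1 hzR).2
  · intro z hz i
    by_cases hzR : z ∈ ball y R
    · rw [(hinE z hzR).2.pd_eq, (hin z hzR).1, one_mul]
      simp only [pd, fderiv_sub_const]
    · rw [(houtE z hz.1 hzR).2.pd_eq, (houtE z hz.1 hzR).1.self_of_nhds]
      have hd := (hHd (g z)).comp_hasFDerivAt z
        ((hgz z hz).differentiableAt (by simp)).hasFDerivAt
      have hd' := hd.fderiv
      simp only [pd, Function.comp_def] at hd' ⊢
      rw [hd']
      simp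
  · intro z hz
    by_cases hzR : z ∈ ball y R
    · refine ⟨0, le_rfl, fun i => ?_⟩
      rw [(hinE z hzR).1.pd_eq]
      simp [pd]
    · refine ⟨deriv θ (g z), hθm.deriv_nonneg, fun i => ?_⟩
      rw [(houtE z hz.1 hzR).1.pd_eq]
      have hd := (hθ.differentiable (by simp) (g z)).hasDerivAt.comp_hasFDerivAt z
        ((hgz z hz).differentiableAt (by simp)).hasFDerivAt
      have hd' := hd.fderiv
      simp only [pd, Function.comp_def] at hd' ⊢
      rw [hd']
      simp
  · intro z hz
    rcases hcases z hz with h1 | ⟨h1, -⟩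
    · rw [h1]
      calc |g z - c| ≤ |g z| + |c| := abs_sub _ _
        _ ≤ |g z| + κ₀ := by rw [abs_of_nonneg hc0]; linarith
    · rw [h1]
      linarith [hHa (g z)]
  · intro z hz
    rcases hcases z hz with h1 | ⟨h1, -⟩
    · linarith [hpos z hz.1 hz.2]
    · linarith [hHn (g z)]
  · intro z hz hzR
    rcases hcases z hz with h1 | ⟨h1, -⟩
    · rw [(houtE z hz.1 fun h => hzR (ball_subset_closedBall h)).2.self_of_nhds]
      exact hHn _
    · rw [h1]
      exact hHn _
  · intro z hz
    rcases hcases z hz with h1 | ⟨h1, -⟩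
    · linarith
    · rcases le_total (2 * κ) (g z) with h2 | h2
      · linarith [hHc _ h2]
      · linarith [hHn (g z)]

/-- The formal adjoint `L* φ = -Δφ - B·∇φ - (div B) φ` of `L = -Δ + B·∇`. -/
def adjointOp {n : ℕ} (B : Euc n → Euc n) (φ : Euc n → ℝ) (z : Euc n) : ℝ :=
  -lap φ z - ⟪B z, gradient φ z⟫ - divg B z * φ z

lemma pd_add {n : ℕ} {i : Fin n} {f g : Euc n → ℝ} {z : Euc n}
    (hf : DifferentiableAt ℝ f z) (hg : DifferentiableAt ℝ g z) :
    pd i (fun w => f w + g w) z = pd i f z + pd i g z := by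
  simp only [pd]
  rw [fderiv_fun_add hf hg]
  simp

lemma contDiffOn_coord {n : ℕ} {B : Euc n → Euc n} {s : Set (Euc n)} (hB : ContDiffOn ℝ 1 B s)
    (i : Fin n) : ContDiffOn ℝ 1 (fun z => B z i) s :=
  (EuclideanSpace.proj (𝕜 := ℝ) i).contDiff.comp_contDiffOn hB

lemma divg_eq_sum_pd {n : ℕ} {B : Euc n → Euc n} {z : Euc n} (hB : DifferentiableAt ℝ B z) :
    divg B z = ∑ i, pd i (fun w => B w i) z := by
  refine Finset.sum_congr rfl fun i _ => ?_
  have h : fderiv ℝ (fun w => B w i) z = (EuclideanSpace.proj (𝕜 := ℝ) i) ∘L fderiv ℝ B z :=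
    ((EuclideanSpace.proj (𝕜 := ℝ) i).hasFDerivAt.comp z hB.hasFDerivAt).fderiv
  rw [pd, h, EuclideanSpace.inner_single_right]
  simp

lemma adjointOp_eq_neg_sum {n : ℕ} {B : Euc n → Euc n} {φ : Euc n → ℝ}
    (hB : ContDiffOn ℝ 1 B (ball 0 1)) (hφ : ContDiffOn ℝ (⊤ : ℕ∞) φ (ball 0 1))
    {z : Euc n} (hz : z ∈ ball (0 : Euc n) 1) :
    adjointOp B φ z = -∑ i, pd i (fun w => pd i φ w + B w i * φ w) z := by
  have hzn := isOpen_ball.mem_nhds hz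
  have hBz : DifferentiableAt ℝ B z := (hB.contDiffAt hzn).differentiableAt (by simp)
  have hφz : DifferentiableAt ℝ φ z := (hφ.contDiffAt hzn).differentiableAt (by simp)
  have hpz : ∀ i, DifferentiableAt ℝ (pd i φ) z := fun i =>
    ((contDiffOn_pd i isOpen_ball hφ (m := 1) (by norm_cast)).contDiffAt hzn).differentiableAt
      (by simp)
  have hBi : ∀ i, DifferentiableAt ℝ (fun w => B w i) z := fun i =>
    ((contDiffOn_coord hB i).contDiffAt hzn).differentiableAt (by simp)
  have h : ∀ i, pd i (fun w => pd i φ w + B w i * φ w) z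
      = pd i (pd i φ) z + (pd i (fun w => B w i) z * φ z + B z i * pd i φ z) := fun i => by
    rw [pd_add (hpz i) ((hBi i).fun_mul hφz), pd_mul (hBi i) hφz]
  simp only [h, adjointOp, lap, inner_gradient_eq_sum, divg_eq_sum_pd hBz,
    Finset.sum_add_distrib, Finset.sum_mul]
  ring

lemma continuousOn_adjointOp {n : ℕ} {B : Euc n → Euc n} {φ : Euc n → ℝ}
    (hB : ContDiffOn ℝ 1 B (ball 0 1)) (hφ : ContDiffOn ℝ (⊤ : ℕ∞) φ (ball 0 1)) :
    ContinuousOn (adjointOp B φ) (ball 0 1) := by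
  have hW1 : ∀ i, ContDiffOn ℝ 1 (fun w => pd i φ w + B w i * φ w) (ball 0 1) := fun i =>
    (contDiffOn_pd i isOpen_ball hφ (m := 1) (by norm_cast)).add
      ((contDiffOn_coord hB i).mul (hφ.of_le (by norm_cast)))
  have hWd : ∀ i, ContinuousOn (pd i fun w => pd i φ w + B w i * φ w) (ball 0 1) := fun i =>
    (contDiffOn_pd i isOpen_ball (hW1 i) (m := 0) (by simp)).continuousOn
  exact (continuousOn_finsetSum _ fun i _ => hWd i).neg.congr fun z hz =>
    adjointOp_eq_neg_sum hB hφ hz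

/-- If `φ ≥ 0` is smooth with `L* φ ≥ 0` on the ball, then `∫ g L* φ ≤ φ(y)` over any closed ball
not containing the pole. -/
theorem IsGreenPole.setIntegral_mul_adjointOp_le {n : ℕ} (hn : 2 ≤ n) {B : Euc n → Euc n}
    {y : Euc n} {g : Euc n → ℝ} (hB : ContDiffOn ℝ 1 B (ball 0 1)) (hg : IsGreenPole B y g)
    (hy : y ∈ ball (0 : Euc n) 1) {φ : Euc n → ℝ} (hφ : ContDiffOn ℝ (⊤ : ℕ∞) φ (ball 0 1))
    (hφ0 : ∀ z ∈ ball (0 : Euc n) 1, 0 ≤ φ z)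
    (hQ : ∀ z ∈ ball (0 : Euc n) 1, 0 ≤ adjointOp B φ z) {x : Euc n} {ε : ℝ}
    (hx : closedBall x ε ⊆ ball 0 1) (hyx : y ∉ closedBall x ε) :
    ∫ z in closedBall x ε, g z * adjointOp B φ z ≤ φ y := by
  set S := closedBall x ε with hS
  obtain ⟨R, hR, hRsub⟩ : ∃ R > 0, closedBall y R ⊆ ball 0 1 \ S :=
    Metric.nhds_basis_closedBall.mem_iff.1
      ((isOpen_ball.sdiff isClosed_closedBall).mem_nhds ⟨hy, hyx⟩)
  set T := closedBall y R with hT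
  set W : Fin n → Euc n → ℝ := fun i w => pd i φ w + B w i * φ w with hW
  set Q : Euc n → ℝ := fun z => -∑ i, pd i (W i) z with hQdef
  have hQeq : ∀ z ∈ ball (0 : Euc n) 1, adjointOp B φ z = Q z := fun z hz =>
    adjointOp_eq_neg_sum hB hφ hz
  have hφ1 : ContDiffOn ℝ 1 φ (ball 0 1) := hφ.of_le (by norm_cast)
  have hW1 : ∀ i, ContDiffOn ℝ 1 (W i) (ball 0 1) := fun i =>
    (contDiffOn_pd i isOpen_ball hφ (m := 1) (by norm_cast)).add
      ((contDiffOn_coord hB i).mul hφ1)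
  have hWd : ∀ i, ContinuousOn (pd i (W i)) (ball 0 1) := fun i =>
    (contDiffOn_pd i isOpen_ball (hW1 i) (m := 0) (by simp)).continuousOn
  have hQc : ContinuousOn Q (ball 0 1) :=
    (continuousOn_adjointOp hB hφ).congr fun z hz => (hQeq z hz).symm
  have hQ0 : ∀ z ∈ ball (0 : Euc n) 1, 0 ≤ Q z := fun z hz => hQeq z hz ▸ hQ z hz
  have hTb : T ⊆ ball 0 1 := hRsub.trans sdiff_subset
  have hST : S ∪ T ⊆ ball 0 1 := union_subset hx hTb
  have hgS : ContinuousOn g S := hg.2.1.continuousOn.mono fun z hz =>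
    ⟨hx hz, by rintro rfl; exact hyx hz⟩
  have hSi : IntegrableOn (fun z => g z * Q z) S :=
    (hgS.mul (hQc.mono hx)).integrableOn_compact (isCompact_closedBall _ _)
  have hSTi : IntegrableOn Q (S ∪ T) :=
    (hQc.mono hST).integrableOn_compact
      ((isCompact_closedBall _ _).union (isCompact_closedBall _ _))
  have hSTm : MeasurableSet (S ∪ T) := measurableSet_closedBall.union measurableSet_closedBall
  set C := ∫ z in S ∪ T, Q z with hC
  have hC0 : 0 ≤ C := setIntegral_nonneg hSTm fun z hz => hQ0 z (hST hz)
  have hcongr : ∫ z in S, g z * adjointOp B φ z = ∫ z in S, g z * Q z :=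
    setIntegral_congr_fun measurableSet_closedBall fun z hz => by simp only [hQeq z (hx hz)]
  rw [hcongr]
  suffices hmain : ∀ κ₀ > 0, ∫ z in S, g z * Q z ≤ φ y + κ₀ * C by
    refine le_of_forall_pos_le_add fun e he => (hmain (e / (C + 1)) (by positivity)).trans ?_
    have : e / (C + 1) * C ≤ e := by
      rw [div_mul_eq_mul_div, div_le_iff₀ (by positivity)]
      nlinarith
    linarith
  intro κ₀ hκ₀
  obtain ⟨h, G, t, r, ht, hr, hh1, hhr, hht, hG1, hGt, hdG, hdh, hGa, hGκ, hG0, hGg⟩ :=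
    hg.exists_truncation hR hTb hκ₀
  have htb : ∀ z : Euc n, ¬ t < ‖z‖ → z ∈ ball (0 : Euc n) 1 := fun z hz => by
    rw [mem_ball, dist_zero_right]; linarith
  have hbt : ∀ z : Euc n, z ∉ ball (0 : Euc n) 1 → t < ‖z‖ := fun z hz => by
    rw [mem_ball, dist_zero_right] at hz; linarith
  have hdGt : ∀ z, t < ‖z‖ → ∀ i, pd i G z = 0 := fun z hz i =>
    pd_zero_of_eventually ((eventually_lt_norm hz).mono hGt)
  have hne := ae_ne_point hn y
  have hgrad := hg.2.2.2.1
  have hGi : IntegrableOn G (ball 0 1) := by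
    have hae : (ball (0 : Euc n) 1 \ {y} : Set (Euc n)) =ᵐ[volume] ball (0 : Euc n) 1 := by
      have : Nonempty (Fin n) := ⟨⟨0, by omega⟩⟩
      exact sdiff_null_ae_eq_self (by simp)
    rw [← integrableOn_congr_set_ae hae]
    have hUm := (isOpen_ball_diff y).measurableSet
    have hgi : IntegrableOn (fun z => |g z| + κ₀) (ball 0 1 \ {y}) := by
      refine Integrable.add (hg.2.2.1.mono_set sdiff_subset).abs (integrableOn_const ?_)
      exact ((measure_mono sdiff_subset).trans_lt measure_ball_lt_top).ne
    refine Integrable.mono' hgi (hG1.continuousOn.aestronglyMeasurable hUm) ?_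
    filter_upwards [ae_restrict_mem hUm] with z hz using hGa z hz
  have hdGi : ∀ i, IntegrableOn (pd i G) (ball 0 1) := by
    intro i
    have h1 : Integrable (fun z => pd i g z * h z) :=
      integrable_mul_of_ball ht (integrableOn_pd i hgrad) hh1.continuousOn fun z hz => by
        rw [hht z hz, mul_zero]
    refine h1.integrableOn.congr ?_
    filter_upwards [ae_restrict_mem measurableSet_ball, ae_restrict_of_ae hne] with z hz hzy
    rw [hdG z ⟨hz, hzy⟩ i, mul_comm]
  have hdGW : ∀ i, Integrable fun z => pd i G z * W i z := fun i =>
    integrable_mul_of_ball ht (hdGi i) (hW1 i).continuousOn fun z hz => by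
      rw [hdGt z hz, zero_mul]
  have hGW : ∀ i, Integrable fun z => G z * pd i (W i) z := fun i =>
    integrable_mul_of_ball ht hGi (hWd i) fun z hz => by rw [hGt z hz, zero_mul]
  have hGQ : Integrable fun z => G z * Q z :=
    integrable_mul_of_ball ht hGi hQc fun z hz => by rw [hGt z hz, zero_mul]
  have hparts : ∫ z, ∑ i, pd i G z * W i z = ∫ z, G z * Q z := by
    rw [integral_finsetSum _ fun i _ => hdGW i]
    simp only [fun i => integral_pd_mul_eq_neg hn i ht hG1 hGi (hdGi i) hGt (hW1 i)]
    rw [Finset.sum_neg_distrib, ← integral_finsetSum _ fun i _ => hGW i, ← integral_neg]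
    simp only [hQdef, Finset.mul_sum, mul_neg]
  have hweak : ∫ z, ∑ i, pd i G z * W i z ≤ φ y := by
    set η : Euc n → ℝ := fun z => h z * φ z with hη
    have hηt : ∀ z, t < ‖z‖ → ∀ᶠ w in 𝓝 z, η w = 0 := fun z hz =>
      (eventually_lt_norm hz).mono fun w hw => by simp [hη, hht w hw]
    have hηs : tsupport η ⊆ closedBall 0 t := by
      intro z hz
      by_contra hz'
      rw [mem_closedBall, dist_zero_right, not_le] at hz'
      exact notMem_tsupport_iff_eventuallyEq.2 (hηt z hz') hz
    have hηb : tsupport η ⊆ ball 0 1 := hηs.trans (closedBall_subset_ball ht)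
    have hη1 : ContDiff ℝ 1 η := contDiff_of_forall_mem_tsupport fun z hz =>
      (hh1.mul hφ1).contDiffAt (isOpen_ball.mem_nhds (hηb hz))
    have hηc : HasCompactSupport η :=
      (isCompact_closedBall _ _).of_isClosed_subset (isClosed_tsupport _) hηs
    have hηr : ContDiffOn ℝ (⊤ : ℕ∞) η (ball y r) :=
      (hφ.mono fun z hz => (hhr z hz).1).congr fun z hz => by simp [hη, (hhr z hz).2]
    have h1 := hg.integral_eq_apply hn hB.continuousOn hη1 hηc hηb hr hηr
    rw [setIntegral_eq_integral_of_forall_compl_eq_zero] at h1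
    · have hηy : η y = φ y := by simp [hη, (hhr y (mem_ball_self hr)).2]
      rw [← hηy, ← h1]
      refine integral_mono_ae (integrable_finsetSum _ fun i _ => hdGW i)
        (integrable_weak_integrand hB.continuousOn hgrad hη1 hηc hηb) ?_
      filter_upwards [hne] with z hzy
      rw [weak_integrand_eq]
      refine Finset.sum_le_sum fun i _ => ?_
      by_cases hzt : t < ‖z‖
      · rw [hdGt z hzt, pd_zero_of_eventually (hηt z hzt), (hηt z hzt).self_of_nhds]
        simp
      · have hzb := htb z hzt
        obtain ⟨a, ha, hdha⟩ := hdh z ⟨hzb, hzy⟩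
        have hzn := isOpen_ball.mem_nhds hzb
        rw [hdG z ⟨hzb, hzy⟩, hη, pd_mul ((hh1.contDiffAt hzn).differentiableAt (by simp))
          ((hφ1.contDiffAt hzn).differentiableAt (by simp)), hdha]
        have h2 : 0 ≤ a * φ z * (pd i g z * pd i g z) :=
          mul_nonneg (mul_nonneg ha (hφ0 z hzb)) (mul_self_nonneg _)
        simp only [hW]
        linarith
    · intro z hz
      have hzt := hbt z hz
      rw [weak_integrand_eq, (hηt z hzt).self_of_nhds]
      simp [pd_zero_of_eventually (hηt z hzt)]
  have hi1 : Integrable (S.indicator fun z => g z * Q z) :=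
    hSi.integrable_indicator measurableSet_closedBall
  have hi2 : Integrable ((S ∪ T).indicator fun z => κ₀ * Q z) :=
    (integrable_indicator_iff hSTm).2 (Integrable.const_mul hSTi κ₀)
  have hlower : ∫ z, (S.indicator (fun z => g z * Q z) z - (S ∪ T).indicator (fun z => κ₀ * Q z) z)
      ≤ ∫ z, G z * Q z := by
    refine integral_mono_ae (hi1.sub hi2) hGQ ?_
    filter_upwards [hne] with z hzy
    by_cases hzb : z ∈ ball (0 : Euc n) 1
    · have hzU : z ∈ ball (0 : Euc n) 1 \ {y} := ⟨hzb, hzy⟩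
      have hq := hQ0 z hzb
      by_cases hzS : z ∈ S
      · rw [indicator_of_mem hzS, indicator_of_mem (mem_union_left T hzS)]
        nlinarith [mul_le_mul_of_nonneg_right (hGg z hzU) hq]
      · rw [indicator_of_notMem hzS]
        by_cases hzT : z ∈ T
        · rw [indicator_of_mem (mem_union_right S hzT)]
          nlinarith [mul_le_mul_of_nonneg_right (hGκ z hzU) hq]
        · rw [indicator_of_notMem (by simp [hzS, hzT])]
          simpa using mul_nonneg (hG0 z hzU hzT) hq
    · rw [indicator_of_notMem (fun h => hzb (hx h)), indicator_of_notMem (fun h => hzb (hST h)),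
        hGt z (hbt z hzb)]
      simp
  rw [integral_sub hi1 hi2, integral_indicator measurableSet_closedBall, integral_indicator hSTm,
    integral_const_mul] at hlower
  linarith

lemma AdmissibleDrift.norm_le {n : ℕ} {β M : ℝ} {B : Euc n → Euc n} (hB : AdmissibleDrift β M B)
    {z : Euc n} (hz : z ∈ ball (0 : Euc n) 1) : ‖B z‖ ≤ M * (1 - ‖z‖) ^ (β - 1) := by
  have hδ : 0 < 1 - ‖z‖ := by
    have : ‖z‖ < 1 := by simpa using hz
    linarith
  have h := hB.2.1 z hz
  have h2 : (1 - ‖z‖) ^ (β - 1) * (1 - ‖z‖) ^ (1 - β) = 1 := by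
    rw [← Real.rpow_add hδ]; simp
  calc ‖B z‖ = ((1 - ‖z‖) ^ (1 - β) * ‖B z‖) * (1 - ‖z‖) ^ (β - 1) := by
        linear_combination -‖B z‖ * h2
    _ ≤ _ := by gcongr

/-- The operator `-Δφ - B·∇φ`. -/
def driftOp {n : ℕ} (B : Euc n → Euc n) (φ : Euc n → ℝ) (z : Euc n) : ℝ :=
  -lap φ z - ⟪B z, gradient φ z⟫

lemma driftOp_add {n : ℕ} {B : Euc n → Euc n} {f g : Euc n → ℝ} {z : Euc n}
    (hf : ContDiffOn ℝ (⊤ : ℕ∞) f (ball 0 1)) (hg : ContDiffOn ℝ (⊤ : ℕ∞) g (ball 0 1))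
    (hz : z ∈ ball (0 : Euc n) 1) :
    driftOp B (fun w => f w + g w) z = driftOp B f z + driftOp B g z := by
  have hd : ∀ {u : Euc n → ℝ}, ContDiffOn ℝ (⊤ : ℕ∞) u (ball 0 1) →
      ∀ w ∈ ball (0 : Euc n) 1, DifferentiableAt ℝ u w := fun hu w hw =>
    (hu.contDiffAt (isOpen_ball.mem_nhds hw)).differentiableAt (by simp)
  have hp : ∀ i, ∀ w ∈ ball (0 : Euc n) 1,
      pd i (fun w => f w + g w) w = pd i f w + pd i g w := fun i w hw =>
    pd_add (hd hf w hw) (hd hg w hw)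
  have hpp : ∀ i, pd i (pd i fun w => f w + g w) z = pd i (pd i f) z + pd i (pd i g) z := by
    intro i
    have h : pd i (fun w => f w + g w) =ᶠ[𝓝 z] fun w => pd i f w + pd i g w := by
      filter_upwards [isOpen_ball.mem_nhds hz] with w hw using hp i w hw
    rw [h.pd_eq]
    exact pd_add (hd (contDiffOn_pd i isOpen_ball hf (by norm_cast)) z hz)
      (hd (contDiffOn_pd i isOpen_ball hg (by norm_cast)) z hz)
  simp only [driftOp, lap, inner_gradient_eq_sum, hpp, hp _ z hz, mul_add, Finset.sum_add_distrib]
  ring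

lemma pd_radial {n : ℕ} {i : Fin n} {f : ℝ → ℝ} {f' : ℝ} {a z : Euc n}
    (hf : HasDerivAt f f' (‖z - a‖ ^ 2)) :
    pd i (fun w => f (‖w - a‖ ^ 2)) z = f' * (2 * (z - a) i) := by
  have h1 : HasFDerivAt (fun w : Euc n => ‖w - a‖ ^ 2) (2 • innerSL ℝ (z - a)) z := by
    have := (((hasFDerivAt_id z).sub_const a).norm_sq)
    simpa using this
  have h2 := (hf.comp_hasFDerivAt z h1).fderiv
  simp only [Function.comp_def] at h2
  rw [pd, h2]
  simp [EuclideanSpace.inner_single_right]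

lemma driftOp_radial_ge {n : ℕ} {B : Euc n → Euc n} {f f' : ℝ → ℝ} {f'' : ℝ} {a z : Euc n}
    (hf : ∀ᶠ s in 𝓝 (‖z - a‖ ^ 2), HasDerivAt f (f' s) s)
    (hf' : HasDerivAt f' f'' (‖z - a‖ ^ 2)) :
    -(4 * ‖z - a‖ ^ 2 * f'' + 2 * n * f' (‖z - a‖ ^ 2))
        - 2 * |f' (‖z - a‖ ^ 2)| * ‖B z‖ * ‖z - a‖
      ≤ driftOp B (fun w => f (‖w - a‖ ^ 2)) z := by
  have hcont : Continuous fun w : Euc n => ‖w - a‖ ^ 2 := by fun_prop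
  have hp : ∀ i, pd i (fun w => f (‖w - a‖ ^ 2)) =ᶠ[𝓝 z]
      fun w => f' (‖w - a‖ ^ 2) * (2 * (w - a) i) := fun i => by
    filter_upwards [hcont.continuousAt.eventually hf] with w hw using pd_radial hw
  have hc : ∀ i, HasFDerivAt (fun w : Euc n => 2 * (w - a) i)
      ((2 : ℝ) • EuclideanSpace.proj (𝕜 := ℝ) i) z := fun i => by
    have := ((EuclideanSpace.proj (𝕜 := ℝ) i).hasFDerivAt.comp z
      ((hasFDerivAt_id z).sub_const a)).const_mul 2
    simpa [Function.comp_def] using this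
  have hn : DifferentiableAt ℝ (fun w : Euc n => ‖w - a‖ ^ 2) z :=
    (differentiableAt_id.sub_const a).norm_sq ℝ
  have hpp : ∀ i, pd i (pd i fun w => f (‖w - a‖ ^ 2)) z
      = f'' * (2 * (z - a) i) * (2 * (z - a) i) + f' (‖z - a‖ ^ 2) * 2 := fun i => by
    have h1 : pd i (fun w : Euc n => 2 * (w - a) i) z = 2 := by
      rw [pd, (hc i).fderiv]; simp
    have h2 : DifferentiableAt ℝ (fun w : Euc n => f' (‖w - a‖ ^ 2)) z :=
      hf'.differentiableAt.comp z hn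
    rw [(hp i).pd_eq, pd_mul h2 (hc i).differentiableAt,
      pd_radial hf', h1]
  have hsq : ∑ i, (z - a) i * (z - a) i = ‖z - a‖ ^ 2 := by
    rw [EuclideanSpace.norm_sq_eq]
    simp [sq]
  have hlap : lap (fun w => f (‖w - a‖ ^ 2)) z
      = 4 * ‖z - a‖ ^ 2 * f'' + 2 * n * f' (‖z - a‖ ^ 2) := by
    simp only [lap, hpp, Finset.sum_add_distrib]
    rw [← hsq, Finset.mul_sum, Finset.sum_mul]
    simp only [Finset.sum_const, Finset.card_univ, Fintype.card_fin, nsmul_eq_mul]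
    congr 1
    · exact Finset.sum_congr rfl fun i _ => by ring
    · ring
  have hinner : ⟪B z, gradient (fun w => f (‖w - a‖ ^ 2)) z⟫
      = 2 * f' (‖z - a‖ ^ 2) * ⟪B z, z - a⟫ := by
    rw [inner_gradient_eq_sum, PiLp.inner_apply, Finset.mul_sum]
    refine Finset.sum_congr rfl fun i _ => ?_
    rw [(hp i).self_of_nhds]
    simp
    ring
  have hle : 2 * f' (‖z - a‖ ^ 2) * ⟪B z, z - a⟫
      ≤ 2 * |f' (‖z - a‖ ^ 2)| * ‖B z‖ * ‖z - a‖ := by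
    calc _ ≤ |2 * f' (‖z - a‖ ^ 2) * ⟪B z, z - a⟫| := le_abs_self _
      _ = 2 * |f' (‖z - a‖ ^ 2)| * |⟪B z, z - a⟫| := by rw [abs_mul, abs_mul]; norm_num
      _ ≤ 2 * |f' (‖z - a‖ ^ 2)| * (‖B z‖ * ‖z - a‖) := by
        gcongr; exact abs_real_inner_le_norm _ _
      _ = _ := by ring
  rw [driftOp, hlap, hinner]
  linarith

/-- A bounded radial barrier controlling the blow-up of the drift at the boundary. -/
lemma exists_boundary_barrier {n : ℕ} (hn : 3 ≤ n) {β M : ℝ} (hβ0 : 0 < β) (hβ1 : β < 1)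
    (hM : 0 < M) : ∃ c > 0, ∃ f : ℝ → ℝ, (∀ s < 1, 0 ≤ f s ∧ f s ≤ 1) ∧
      ContDiffOn ℝ (⊤ : ℕ∞) f (Iio 1) ∧
      ∀ C ≥ 0, ∀ B : Euc n → Euc n, AdmissibleDrift β M B → ∀ z ∈ ball (0 : Euc n) 1,
        C * c * (1 - ‖z‖) ^ (β - 1) ≤ driftOp B (fun w => C * f (‖w - 0‖ ^ 2)) z := by
  set L : ℝ := M ^ 2 + 4 with hL
  have hLpos : 0 < L := by positivity
  set K : ℝ := L / β with hK
  have hKpos : 0 < K := by positivity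
  have hKL : K * β = L := by rw [hK]; field_simp
  set E : ℝ → ℝ := fun s => Real.exp (-(K * (1 - s) ^ β)) with hE
  have hEle : ∀ s < 1, E s ≤ 1 := fun s hs => by
    have : 0 ≤ (1 - s) ^ β := Real.rpow_nonneg (by linarith) _
    exact Real.exp_le_one_iff.2 (by nlinarith)
  have hEd : ∀ s < 1, HasDerivAt E (E s * (L * (1 - s) ^ (β - 1))) s := by
    intro s hs
    have h1 : HasDerivAt (fun s : ℝ => 1 - s) (-1) s := by
      simpa using (hasDerivAt_id s).const_sub 1
    have h2 := ((h1.rpow_const (p := β) (Or.inl (by linarith : 1 - s ≠ 0))).const_mul K).fun_neg.exp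
    convert h2 using 1
    rw [← hKL]
    ring
  refine ⟨L * Real.exp (-K) / 2, by positivity, fun s => 1 - E s, ?_, ?_, ?_⟩
  · intro s hs
    exact ⟨by linarith [hEle s hs], by linarith [Real.exp_pos (-(K * (1 - s) ^ β))]⟩
  · refine contDiffOn_const.sub (ContDiffOn.exp (ContDiffOn.neg (contDiffOn_const.mul ?_)))
    refine ContDiffOn.rpow_const_of_ne (contDiffOn_const.sub contDiffOn_id) fun s hs => ?_
    have : s < 1 := hs
    exact (sub_pos.2 this).ne'
  intro C hC B hB z hz
  have hz1 : ‖z‖ < 1 := by simpa using hz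
  set s := ‖z‖ with hs
  have hs0 : 0 ≤ s := norm_nonneg z
  have hτ : s ^ 2 < 1 := by nlinarith
  set u := 1 - s ^ 2 with hu
  have hu0 : 0 < u := by linarith
  have hu1 : u ≤ 1 := by nlinarith
  set q := u ^ (β - 1) with hq
  have hq1 : 1 ≤ q := Real.one_le_rpow_of_pos_of_le_one_of_nonpos hu0 hu1 (by linarith)
  have hδ : (1 - s) ^ (β - 1) ≤ 2 * q := by
    have h1 : u / 2 ≤ 1 - s := by nlinarith
    calc (1 - s) ^ (β - 1) ≤ (u / 2) ^ (β - 1) :=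
          Real.rpow_le_rpow_of_nonpos (by linarith) h1 (by linarith)
      _ = q * 2 ^ (1 - β) := by
          rw [Real.div_rpow hu0.le (by norm_num), div_eq_mul_inv, ← Real.rpow_neg (by norm_num)]
          congr 2; ring
      _ ≤ q * 2 ^ (1 : ℝ) := by
          gcongr
          · norm_num
          · linarith
      _ = 2 * q := by rw [Real.rpow_one]; ring
  have hf : ∀ᶠ t in 𝓝 (‖z - 0‖ ^ 2), HasDerivAt (fun t => C * (1 - E t))
      (-(C * (L * ((1 - t) ^ (β - 1) * E t)))) t := by
    rw [sub_zero]
    filter_upwards [Iio_mem_nhds hτ] with t ht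
    refine ((hEd t ht).const_sub 1).const_mul C |>.congr_deriv ?_
    ring
  have hf' : HasDerivAt (fun t => -(C * (L * ((1 - t) ^ (β - 1) * E t))))
      (-(C * (L * ((1 - β) * u ^ (β - 2) * E (s ^ 2) + q * (E (s ^ 2) * (L * q))))))
      (‖z - 0‖ ^ 2) := by
    rw [sub_zero]
    have h1 : HasDerivAt (fun s : ℝ => 1 - s) (-1) (s ^ 2) := by
      simpa using (hasDerivAt_id (s ^ 2)).const_sub 1
    have h2 := (h1.rpow_const (p := β - 1) (Or.inl (by linarith : 1 - s ^ 2 ≠ 0)))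
    have h3 := (((h2.fun_mul (hEd _ hτ)).const_mul L).const_mul C).fun_neg
    refine h3.congr_deriv ?_
    rw [show β - 1 - 1 = β - 2 by ring]
    ring
  refine le_trans ?_ (driftOp_radial_ge (f := fun t => C * (1 - E t)) (B := B) hf hf')
  rw [sub_zero, ← hs, ← hu, ← hq]
  set F := E (s ^ 2) with hF
  have hF0 : 0 < F := Real.exp_pos _
  have hFK : Real.exp (-K) ≤ F := by
    refine Real.exp_le_exp.2 ?_
    have : (1 - s ^ 2) ^ β ≤ 1 := Real.rpow_le_one hu0.le hu1 hβ0.le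
    nlinarith
  have hBz : ‖B z‖ ≤ 2 * M * q := by
    have := hB.norm_le hz
    nlinarith
  have hqK : q ≤ 4 / 3 ∨ 1 / 4 ≤ s ^ 2 := by
    by_cases h : 1 / 4 ≤ s ^ 2
    · exact Or.inr h
    · left
      have h1 : (3 : ℝ) / 4 ≤ u := by linarith
      calc q ≤ (3 / 4 : ℝ) ^ (β - 1) :=
            Real.rpow_le_rpow_of_nonpos (by norm_num) h1 (by linarith)
        _ ≤ (3 / 4 : ℝ) ^ (-1 : ℝ) :=
            Real.rpow_le_rpow_of_exponent_ge (by norm_num) (by norm_num) (by linarith)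
        _ = 4 / 3 := by rw [Real.rpow_neg_one]; norm_num
  have hn3 : (3 : ℝ) ≤ n := by exact_mod_cast hn
  have hbr : 1 ≤ 4 * s ^ 2 * (L * q) + 2 * n - 4 * M * q * s := by
    have h1 : 4 * M * s ≤ 2 * L * s ^ 2 + 2 := by
      nlinarith [sq_nonneg (M * s - 1), sq_nonneg s]
    have h2 : 4 * M * s * q ≤ (2 * L * s ^ 2 + 2) * q := by gcongr
    have h3 : 2 * q + 1 ≤ 2 * L * s ^ 2 * q + 6 := by
      rcases hqK with h | h
      · have : 0 ≤ 2 * L * s ^ 2 * q := by positivity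
        linarith
      · have h4 : 2 ≤ 2 * L * s ^ 2 := by nlinarith [sq_nonneg M]
        nlinarith
    nlinarith
  have habs : |-(C * (L * (q * F)))| = C * (L * (q * F)) := by
    rw [abs_neg, abs_of_nonneg (by positivity)]
  rw [habs]
  have hdrift : 2 * (C * (L * (q * F))) * ‖B z‖ * s ≤ 2 * (C * (L * (q * F))) * (2 * M * q) * s := by
    gcongr
  have hu2 : 0 ≤ 4 * s ^ 2 * (C * (L * ((1 - β) * u ^ (β - 2) * F))) := by
    have : 0 ≤ 1 - β := by linarith
    positivity
  have hmain : C * L * F * q * 1 ≤ C * L * F * q * (4 * s ^ 2 * (L * q) + 2 * n - 4 * M * q * s) := by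
    gcongr
  have hfirst : C * (L * Real.exp (-K) / 2) * (1 - s) ^ (β - 1) ≤ C * L * F * q := by
    calc C * (L * Real.exp (-K) / 2) * (1 - s) ^ (β - 1)
        ≤ C * (L * F / 2) * (2 * q) := by gcongr
      _ = C * L * F * q := by ring
  linarith

lemma hasDerivAt_add_rpow {b p s : ℝ} (hs : 0 < s + b) :
    HasDerivAt (fun t : ℝ => (t + b) ^ p) (p * (s + b) ^ (p - 1)) s := by
  have h := ((hasDerivAt_id s).add_const b).rpow_const (p := p) (Or.inl hs.ne')
  simpa using h

lemma driftOp_regularized_pole_ge {n : ℕ} {B : Euc n → Euc n} {x z : Euc n} {m ε σ : ℝ}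
    (hm : 0 < m) (hε : 0 < ε) (hσ : σ = ‖z - x‖ ^ 2 + ε ^ 2) :
    m * σ ^ (-m - 2) * ((2 * n - 4 * m - 4) * ‖z - x‖ ^ 2 + 2 * n * ε ^ 2)
        - 2 * m * ‖B z‖ * σ ^ (-m - 1 / 2)
      ≤ driftOp B (fun w => (‖w - x‖ ^ 2 + ε ^ 2) ^ (-m)) z := by
  have hσ0 : 0 < σ := by rw [hσ]; positivity
  have hf : ∀ᶠ s in 𝓝 (‖z - x‖ ^ 2), HasDerivAt (fun t : ℝ => (t + ε ^ 2) ^ (-m))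
      (-m * (s + ε ^ 2) ^ (-m - 1)) s := by
    have h0 : -ε ^ 2 < ‖z - x‖ ^ 2 := by
      have : 0 < ε ^ 2 := by positivity
      nlinarith [sq_nonneg ‖z - x‖]
    filter_upwards [Ioi_mem_nhds h0] with s hs
    have hs' : -ε ^ 2 < s := hs
    exact hasDerivAt_add_rpow (by linarith)
  have hf' : HasDerivAt (fun s : ℝ => -m * (s + ε ^ 2) ^ (-m - 1))
      (-m * ((-m - 1) * σ ^ (-m - 2))) (‖z - x‖ ^ 2) := by
    have h := (hasDerivAt_add_rpow (b := ε ^ 2) (p := -m - 1) (s := ‖z - x‖ ^ 2)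
      (by rw [← hσ]; exact hσ0)).const_mul (-m)
    rwa [← hσ, show -m - 1 - 1 = -m - 2 by ring] at h
  refine le_trans ?_ (driftOp_radial_ge (f := fun t : ℝ => (t + ε ^ 2) ^ (-m)) (B := B) hf hf')
  rw [← hσ]
  have h1 : σ ^ (-m - 1) = σ ^ (-m - 2) * σ := by
    rw [← Real.rpow_add_one hσ0.ne']; ring_nf
  have habs : |-m * σ ^ (-m - 1)| = m * σ ^ (-m - 1) := by
    rw [abs_mul, abs_neg, abs_of_pos hm, abs_of_nonneg (by positivity)]
  have h2 : ‖z - x‖ ≤ σ ^ (1 / 2 : ℝ) := by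
    rw [← Real.sqrt_eq_rpow]
    exact Real.le_sqrt_of_sq_le (by rw [hσ]; nlinarith [sq_nonneg ε])
  have h3 : σ ^ (-m - 1) * ‖z - x‖ ≤ σ ^ (-m - 1 / 2) := by
    calc σ ^ (-m - 1) * ‖z - x‖ ≤ σ ^ (-m - 1) * σ ^ (1 / 2 : ℝ) := by gcongr
      _ = σ ^ (-m - 1 / 2) := by rw [← Real.rpow_add hσ0]; ring_nf
  have h4 : 2 * m * ‖B z‖ * (σ ^ (-m - 1) * ‖z - x‖) ≤ 2 * m * ‖B z‖ * σ ^ (-m - 1 / 2) := by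
    gcongr
  have h5 : σ ^ (-m - 2) * σ = σ ^ (-m - 2) * (‖z - x‖ ^ 2 + ε ^ 2) := by rw [← hσ]
  rw [habs]
  rw [h1] at h4 ⊢
  linear_combination h4 - 2 * n * m * h5

lemma contDiff_regularized_pole {n : ℕ} (x : Euc n) (m : ℝ) {ε : ℝ} (hε : 0 < ε) :
    ContDiff ℝ (⊤ : ℕ∞) fun w : Euc n => (‖w - x‖ ^ 2 + ε ^ 2) ^ (-m) := by
  refine ContDiff.rpow_const_of_ne ?_ fun w => by positivity
  exact ((contDiff_id.sub contDiff_const).norm_sq ℝ).add contDiff_const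

/-- Close to the pole the first-order term is absorbed by the weaker of the two poles. -/
lemma first_order_le_of_le_pow_four {b b' k m q σ : ℝ} (hb : 0 ≤ b) (hbb' : b ≤ b') (hk0 : 0 < k)
    (hk : k = m - 1 / 4) (hq0 : 0 < q) (hq1 : q ≤ 1) (hqk : q * (2 * b' * (m + k)) ≤ k)
    (hσ0 : 0 < σ) (hσ : σ ≤ q ^ 4) :
    2 * b * (m * σ ^ (-m - 1 / 2) + k * σ ^ (-k - 1 / 2)) ≤ k * σ ^ (-k - 1) := by
  have hm0 : 0 < m := by linarith
  have hb'0 : 0 ≤ b' := hb.trans hbb'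
  obtain ⟨t, ht⟩ : ∃ t, t = σ ^ (1 / 4 : ℝ) := ⟨_, rfl⟩
  have ht0 : 0 ≤ t := by rw [ht]; positivity
  have htq : t ≤ q := by
    calc t ≤ (q ^ 4) ^ (1 / 4 : ℝ) := by rw [ht]; gcongr
      _ = q := by rw [← Real.rpow_natCast, ← Real.rpow_mul hq0.le]; norm_num
  have e1 : σ ^ (-m - 1 / 2) = σ ^ (-k - 1) * t := by
    rw [ht, ← Real.rpow_add hσ0, hk]; ring_nf
  have e2 : σ ^ (-k - 1 / 2) = σ ^ (-k - 1) * (t * t) := by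
    rw [ht, ← Real.rpow_add hσ0, ← Real.rpow_add hσ0]; ring_nf
  obtain ⟨A, hA⟩ : ∃ A, A = σ ^ (-k - 1) := ⟨_, rfl⟩
  have hA0 : 0 ≤ A := by rw [hA]; positivity
  have htt : t * t ≤ t := mul_le_of_le_one_left ht0 (htq.trans hq1)
  rw [e1, e2, ← hA]
  calc 2 * b * (m * (A * t) + k * (A * (t * t)))
      ≤ 2 * b' * (m * (A * t) + k * (A * t)) := by gcongr
    _ = t * (2 * b' * (m + k)) * A := by ring
    _ ≤ q * (2 * b' * (m + k)) * A := by gcongr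
    _ ≤ k * A := by gcongr

/-- Two regularized poles at `x` plus a multiple of the boundary barrier form a supersolution,
uniformly over admissible drifts and over poles `x` that stay away from the boundary. -/
lemma exists_regularized_supersolution {n : ℕ} (hn : 3 ≤ n) {β M r : ℝ} (hβ0 : 0 < β) (hβ1 : β < 1)
    (hM : 0 < M) (hr : r < 1) {m : ℝ} (hm : m = (n - 2) / 2) :
    ∃ C ≥ 0, ∀ x : Euc n, ‖x‖ ≤ (1 + r) / 2 → ∀ ε > 0, ∃ ψ : Euc n → ℝ,
      ContDiffOn ℝ (⊤ : ℕ∞) ψ (ball 0 1) ∧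
      (∀ z ∈ ball (0 : Euc n) 1, 0 ≤ ψ z ∧
        ψ z ≤ (‖z - x‖ ^ 2 + ε ^ 2) ^ (-m) + (‖z - x‖ ^ 2 + ε ^ 2) ^ (-(m - 1 / 4)) + C) ∧
      ∀ B : Euc n → Euc n, AdmissibleDrift β M B → ∀ z ∈ ball (0 : Euc n) 1,
        2 * n * m * ε ^ 2 * (‖z - x‖ ^ 2 + ε ^ 2) ^ (-m - 2) ≤ driftOp B ψ z := by
  obtain ⟨c, hc, f, hf01, hfs, hfb⟩ := exists_boundary_barrier hn hβ0 hβ1 hM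
  have hn3 : (3 : ℝ) ≤ n := by exact_mod_cast hn
  have hm2 : 1 / 2 ≤ m := by rw [hm]; linarith
  obtain ⟨k, hk⟩ : ∃ k : ℝ, k = m - 1 / 4 := ⟨_, rfl⟩
  rw [← hk]
  have hk0 : 0 < k := by linarith
  have hm0 : 0 < m := by linarith
  obtain ⟨M', hM'⟩ : ∃ M' : ℝ, M' = M * ((1 - r) / 4) ^ (β - 1) := ⟨_, rfl⟩
  have hM'0 : 0 < M' := hM' ▸ mul_pos hM (Real.rpow_pos_of_pos (by linarith) _)
  obtain ⟨q, hq⟩ : ∃ q : ℝ, q = min ((1 - r) / 4) (min 1 (k / (2 * M' * (m + k)))) := ⟨_, rfl⟩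
  have hq0 : 0 < q := hq ▸ lt_min (by linarith) (lt_min one_pos (by positivity))
  have hqr : q ≤ (1 - r) / 4 := hq ▸ min_le_left _ _
  have hq1 : q ≤ 1 := hq ▸ (min_le_right _ _).trans (min_le_left _ _)
  have hqk : q * (2 * M' * (m + k)) ≤ k :=
    (le_div_iff₀ (by positivity)).1 (hq ▸ (min_le_right _ _).trans (min_le_right _ _))
  obtain ⟨D, hD⟩ : ∃ D : ℝ, D = m * (q ^ 4) ^ (-m - 1 / 2) + k * (q ^ 4) ^ (-k - 1 / 2) := ⟨_, rfl⟩
  have hD0 : 0 ≤ D := by rw [hD]; positivity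
  obtain ⟨C, hC⟩ : ∃ C : ℝ, C = 2 * M * D / c := ⟨_, rfl⟩
  have hC0 : 0 ≤ C := by rw [hC]; positivity
  refine ⟨C, hC0, fun x hx ε hε => ⟨fun z => ((‖z - x‖ ^ 2 + ε ^ 2) ^ (-m) +
    (‖z - x‖ ^ 2 + ε ^ 2) ^ (-k)) + C * f (‖z - 0‖ ^ 2), ?_, ?_, ?_⟩⟩
  all_goals
    have hs1 := (contDiff_regularized_pole x m hε).contDiffOn (s := ball 0 1)
    have hs2 := (contDiff_regularized_pole x k hε).contDiffOn (s := ball 0 1)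
    have hball : ∀ z ∈ ball (0 : Euc n) 1, ‖z - 0‖ ^ 2 < 1 := fun z hz => by
      have : ‖z‖ < 1 := by simpa using hz
      rw [sub_zero]
      nlinarith [norm_nonneg z]
    have hs3 : ContDiffOn ℝ (⊤ : ℕ∞) (fun z : Euc n => C * f (‖z - 0‖ ^ 2)) (ball 0 1) :=
      contDiffOn_const.mul (hfs.comp
        ((contDiff_id.sub contDiff_const).norm_sq ℝ).contDiffOn fun z hz => hball z hz)
  · exact (hs1.add hs2).add hs3
  · intro z hz
    have h := hf01 _ (hball z hz)
    have h1 : 0 ≤ C * f (‖z - 0‖ ^ 2) := mul_nonneg hC0 h.1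
    have h2 : C * f (‖z - 0‖ ^ 2) ≤ C := mul_le_of_le_one_right hC0 h.2
    exact ⟨by positivity, by linarith⟩
  intro B hB z hz
  rw [driftOp_add (hs1.add hs2) hs3 hz, driftOp_add hs1 hs2 hz]
  obtain ⟨σ, hσ⟩ : ∃ σ, σ = ‖z - x‖ ^ 2 + ε ^ 2 := ⟨_, rfl⟩
  have hσ0 : 0 < σ := by rw [hσ]; positivity
  have hz1 : ‖z‖ < 1 := by simpa using hz
  have hBz := hB.norm_le hz
  rw [← hσ]
  have hkσ : k * σ ^ (-k - 1) ≤
      k * σ ^ (-k - 2) * ((2 * n - 4 * k - 4) * ‖z - x‖ ^ 2 + 2 * n * ε ^ 2) := by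
    have e1 : σ ^ (-k - 1) = σ ^ (-k - 2) * σ := by
      rw [← Real.rpow_add_one hσ0.ne']; ring_nf
    rw [e1, ← mul_assoc]
    gcongr
    rw [hσ, hk, hm]
    have h4 : 0 ≤ (n - 1 : ℝ) * ε ^ 2 := mul_nonneg (by linarith only [hn3]) (sq_nonneg ε)
    nlinarith only [h4, sq_nonneg ε]
  have hmσ : m * σ ^ (-m - 2) * ((2 * n - 4 * m - 4) * ‖z - x‖ ^ 2 + 2 * n * ε ^ 2)
      = 2 * n * m * ε ^ 2 * σ ^ (-m - 2) := by
    rw [hm]; ring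
  have hkpos : 0 ≤ k * σ ^ (-k - 1) := by positivity
  have hbar : 0 ≤ C * c * (1 - ‖z‖) ^ (β - 1) := by
    have : 0 ≤ 1 - ‖z‖ := by linarith
    positivity
  have hdrift : 2 * ‖B z‖ * (m * σ ^ (-m - 1 / 2) + k * σ ^ (-k - 1 / 2))
      ≤ k * σ ^ (-k - 1) + C * c * (1 - ‖z‖) ^ (β - 1) := by
    rcases le_or_gt σ (q ^ 4) with hnear | hfar
    · have hzx : ‖z - x‖ ≤ (1 - r) / 4 := by
        refine (abs_le_of_sq_le_sq' ?_ hq0.le).2.trans hqr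
        have : q ^ 4 ≤ q ^ 2 := pow_le_pow_of_le_one hq0.le hq1 (by norm_num)
        have h4 : 0 ≤ ε ^ 2 := sq_nonneg ε
        linarith only [this, h4, hnear, hσ]
      have hzr : (1 - r) / 4 ≤ 1 - ‖z‖ := by
        have : ‖z‖ ≤ ‖z - x‖ + ‖x‖ := by simpa using norm_add_le (z - x) x
        linarith only [this, hx, hzx]
      have hBM : ‖B z‖ ≤ M' := hBz.trans <| by
        rw [hM']
        exact mul_le_mul_of_nonneg_left
          (Real.rpow_le_rpow_of_nonpos (by linarith) hzr (by linarith)) hM.le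
      exact (first_order_le_of_le_pow_four (norm_nonneg _) hBM hk0 hk hq0 hq1 hqk hσ0 hnear).trans
        (le_add_of_nonneg_right hbar)
    · have hq4 : 0 < q ^ 4 := by positivity
      have hle : m * σ ^ (-m - 1 / 2) + k * σ ^ (-k - 1 / 2) ≤ D := by
        have i1 := Real.rpow_le_rpow_of_nonpos hq4 hfar.le (by linarith : -m - 1 / 2 ≤ 0)
        have i2 := Real.rpow_le_rpow_of_nonpos hq4 hfar.le (by linarith : -k - 1 / 2 ≤ 0)
        rw [hD]
        gcongr
      calc 2 * ‖B z‖ * (m * σ ^ (-m - 1 / 2) + k * σ ^ (-k - 1 / 2))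
          ≤ 2 * (M * (1 - ‖z‖) ^ (β - 1)) * D := by gcongr
        _ = C * c * (1 - ‖z‖) ^ (β - 1) := by rw [hC]; field_simp
        _ ≤ _ := le_add_of_nonneg_left hkpos
  have h1 := driftOp_regularized_pole_ge (B := B) hm0 hε hσ
  have h2 := driftOp_regularized_pole_ge (B := B) hk0 hε hσ
  have h3 := hfb C hC0 B hB z hz
  rw [hmσ] at h1
  linarith only [h1, h2, h3, hkσ, hdrift]

lemma driftOp_le_adjointOp {n : ℕ} {β M : ℝ} {B : Euc n → Euc n} (hB : AdmissibleDrift β M B)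
    {φ : Euc n → ℝ} {z : Euc n} (hz : z ∈ ball (0 : Euc n) 1) (hφ : 0 ≤ φ z) :
    driftOp B φ z ≤ adjointOp B φ z := by
  have := mul_nonneg (neg_nonneg.2 (hB.2.2 z hz).2) hφ
  rw [driftOp, adjointOp]
  linarith

/-- interior upper bound for the Green's function with pole at `y ∈ B(0,r)`:
`g_y(x) ≤ K' |x - y|^{2-n}` for `0 < |x - y| ≤ δ(y)/2`, with `K'` depending only on
`n`, `M`, `β`, `r`. -/
theorem green_pole_upper_bound
    (n : ℕ) (hn : 3 ≤ n) (β M : ℝ) (hβ0 : 0 < β) (hβ1 : β < 1) (hM : 0 < M)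
    (r : ℝ) (hr0 : 0 < r) (hr1 : r < 1) :
    ∃ K' > (0 : ℝ), ∀ (B : Euc n → Euc n) (g : Euc n → Euc n → ℝ),
      AdmissibleDrift β M B →
      (∀ y ∈ ball (0 : Euc n) 1, IsGreenPole B y (g y)) →
      ∀ y ∈ ball (0 : Euc n) 1, ‖y‖ ≤ r →
        ∀ x ∈ ball (0 : Euc n) 1, x ≠ y → ‖x - y‖ ≤ (1 - ‖y‖) / 2 →
          g y x ≤ K' * ‖x - y‖ ^ ((2 : ℝ) - n) := by
  have hn3 : (3 : ℝ) ≤ n := by exact_mod_cast hn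
  obtain ⟨m, hm⟩ : ∃ m : ℝ, m = (n - 2) / 2 := ⟨_, rfl⟩
  have hm0 : 0 < m := by rw [hm]; linarith
  obtain ⟨C, hC, H⟩ := exists_regularized_supersolution hn hβ0 hβ1 hM hr1 hm
  obtain ⟨v, hv⟩ : ∃ v : ℝ, v = volume.real (ball (0 : Euc n) 1) := ⟨_, rfl⟩
  have hv0 : 0 < v := by
    rw [hv]
    exact ENNReal.toReal_pos (measure_ball_pos _ _ one_pos).ne' measure_ball_lt_top.ne
  obtain ⟨c₁, hc₁⟩ : ∃ c₁ : ℝ, c₁ = 2 * n * m * 2 ^ (-m - 2) := ⟨_, rfl⟩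
  have hc₁0 : 0 < c₁ := by rw [hc₁]; positivity
  refine ⟨2 * (2 + C) / (c₁ * v), by positivity, ?_⟩
  intro B g hB hg y hy hyr x hx hxy hxy2
  have hgy := hg y hy
  obtain ⟨ρ, hρ⟩ : ∃ ρ : ℝ, ρ = ‖x - y‖ := ⟨_, rfl⟩
  have hρ0 : 0 < ρ := by rw [hρ]; exact norm_pos_iff.2 (sub_ne_zero.2 hxy)
  have hρ1 : ρ ≤ 1 := by linarith [norm_nonneg y]
  have hxr : ‖x‖ ≤ (1 + r) / 2 := by
    have : ‖x‖ ≤ ‖x - y‖ + ‖y‖ := by simpa using norm_add_le (x - y) y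
    linarith
  have hgx : 0 < g y x := hgy.1 x hx hxy
  have hopen : ball (0 : Euc n) 1 \ {y} ∈ 𝓝 x :=
    (isOpen_ball.sdiff isClosed_singleton).mem_nhds ⟨hx, hxy⟩
  have hcont : ContinuousAt (g y) x := (hgy.2.1.contDiffAt hopen).continuousAt
  obtain ⟨ε, hε, hεs⟩ := (nhds_basis_closedBall.mem_iff).1
    (inter_mem hopen (hcont.eventually (lt_mem_nhds (half_lt_self hgx))))
  have hball : closedBall x ε ⊆ ball 0 1 := fun z hz => (hεs hz).1.1
  have hyn : y ∉ closedBall x ε := fun h => (hεs h).1.2 rfl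
  obtain ⟨ψ, hψs, hψb, hψd⟩ := H x hxr ε hε
  have hlow : ∀ z ∈ ball (0 : Euc n) 1,
      2 * n * m * ε ^ 2 * (‖z - x‖ ^ 2 + ε ^ 2) ^ (-m - 2) ≤ adjointOp B ψ z := fun z hz =>
    (hψd B hB z hz).trans (driftOp_le_adjointOp hB hz (hψb z hz).1)
  have hQ : ∀ z ∈ ball (0 : Euc n) 1, 0 ≤ adjointOp B ψ z := fun z hz =>
    le_trans (by positivity) (hlow z hz)
  have hmain := hgy.setIntegral_mul_adjointOp_le (by lia) hB.1 hy hψs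
    (fun z hz => (hψb z hz).1) hQ hball hyn
  obtain ⟨a, ha⟩ : ∃ a : ℝ, a = 2 * n * m * ε ^ 2 * (2 * ε ^ 2) ^ (-m - 2) := ⟨_, rfl⟩
  have ha0 : 0 < a := by rw [ha]; positivity
  have hlow' : ∀ z ∈ closedBall x ε, g y x / 2 * a ≤ g y z * adjointOp B ψ z := by
    intro z hz
    have hzε : ‖z - x‖ ≤ ε := by simpa [dist_eq_norm] using hz
    have h1 : a ≤ adjointOp B ψ z := by
      refine le_trans ?_ (hlow z (hball hz))
      rw [ha]
      gcongr ?_ * ?_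
      refine Real.rpow_le_rpow_of_nonpos (by positivity) ?_ (by linarith)
      nlinarith [norm_nonneg (z - x)]
    have h2 : g y x / 2 ≤ g y z := le_of_lt (hεs hz).2
    gcongr
    linarith
  have hvol : volume.real (closedBall x ε) = ε ^ n * v := by
    rw [hv, Measure.real, Measure.addHaar_closedBall _ _ hε.le, finrank_euclideanSpace_fin,
      ENNReal.toReal_mul, ENNReal.toReal_ofReal (by positivity), Measure.real]
  have hac : a * ε ^ n = c₁ := by
    have h1 : (2 * ε ^ 2) ^ (-m - 2) = (2 : ℝ) ^ (-m - 2) * ε ^ (-(n : ℝ) - 2) := by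
      rw [Real.mul_rpow (by norm_num) (by positivity), ← Real.rpow_natCast ε 2,
        ← Real.rpow_mul hε.le, hm]
      congr 2
      push_cast
      ring
    have h2 : ε ^ (-(n : ℝ) - 2) * ε ^ 2 * ε ^ n = 1 := by
      rw [← Real.rpow_natCast, ← Real.rpow_natCast, ← Real.rpow_add hε, ← Real.rpow_add hε]
      push_cast
      ring_nf
      exact Real.rpow_zero _
    rw [ha, hc₁, h1]
    linear_combination (2 * n * m * (2 : ℝ) ^ (-m - 2)) * h2
  have hint : IntegrableOn (fun z => g y z * adjointOp B ψ z) (closedBall x ε) :=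
    ((hgy.2.1.continuousOn.mono fun z hz => (hεs hz).1).mul
      ((continuousOn_adjointOp hB.1 hψs).mono hball)).integrableOn_compact (isCompact_closedBall _ _)
  have hintle : g y x / 2 * a * (ε ^ n * v) ≤ ψ y := by
    refine le_trans ?_ hmain
    have := setIntegral_ge_of_const_le_real measurableSet_closedBall
      measure_closedBall_lt_top.ne hlow' hint
    rwa [hvol] at this
  have hone : 1 ≤ ρ ^ ((2 : ℝ) - n) :=
    Real.one_le_rpow_of_pos_of_le_one_of_nonpos hρ0 hρ1 (by linarith)
  have hψy : ψ y ≤ (2 + C) * ρ ^ ((2 : ℝ) - n) := by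
    have h0 := (hψb y hy).2
    have hσ : ρ ^ 2 ≤ ‖y - x‖ ^ 2 + ε ^ 2 := by
      rw [hρ, norm_sub_rev x y]; nlinarith [sq_nonneg ε]
    have e : ∀ p : ℝ, (ρ ^ 2) ^ p = ρ ^ (2 * p) := fun p => by
      rw [← Real.rpow_natCast ρ 2, ← Real.rpow_mul hρ0.le]; norm_num
    have h1 : (‖y - x‖ ^ 2 + ε ^ 2) ^ (-m) ≤ ρ ^ ((2 : ℝ) - n) := by
      refine (Real.rpow_le_rpow_of_nonpos (by positivity) hσ (by linarith)).trans_eq ?_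
      rw [e, hm]; ring_nf
    have h2 : (‖y - x‖ ^ 2 + ε ^ 2) ^ (-(m - 1 / 4)) ≤ ρ ^ ((2 : ℝ) - n) := by
      refine (Real.rpow_le_rpow_of_nonpos (by positivity) hσ (by rw [hm]; linarith)).trans ?_
      rw [e]
      exact Real.rpow_le_rpow_of_exponent_ge hρ0 hρ1 (by rw [hm]; linarith)
    have h3 : C ≤ C * ρ ^ ((2 : ℝ) - n) := le_mul_of_one_le_right hC hone
    linarith
  rw [← hρ, div_mul_eq_mul_div, le_div_iff₀ (by positivity), ← hac]
  linarith
end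
end
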